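/- Let C be a contour with site set S, and let L be a staircase contour labeling of (C,S) satisfying Assumption 1 (no text box intersects the convex hull of S), in which every left label has its port on the left chain C_L and every right label has its port on the right chain C_R. If no two leaders of L intersect and no two consecutive labels of L (with respect to the radial ordering) intersect, then L is planar, i.e., all labels of L are pairwise disjoint point sets. -/

import Mathlib

open scoped Classical
noncomputable section

/-- Points of the Euclidean plane. -/
abbrev Pt : Type := ℝ × ℝ

/-- Cross product of `b - a` with `p - a`; its sign gives the orientation of `p`
relative to the directed line from `a` to `b`. -/
def cross2 (a b p : Pt) : ℝ := (b.1 - a.1) * (p.2 - a.2) - (b.2 - a.2) * (p.1 - a.1)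

/-- `p` lies strictly to the right of the directed line from `a` to `b`. -/
def StrictRightOf (a b p : Pt) : Prop := cross2 a b p < 0

/-- `p` lies strictly to the left of the directed line from `a` to `b`. -/
def StrictLeftOf (a b p : Pt) : Prop := 0 < cross2 a b p

/-- `p` lies on or to the left of the directed line from `a` to `b`. -/
def LeftOrOn (a b p : Pt) : Prop := 0 ≤ cross2 a b p

/-- The line through two points `a` and `b`. -/
def lineThrough (a b : Pt) : Set Pt := {p | cross2 a b p = 0}

/-- The half-line emanating from `a` through `b`. -/
def halfLine (a b : Pt) : Set Pt := {p | ∃ t : ℝ, 0 ≤ t ∧ p = a + t • (b - a)}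

/-- A contour: a compact convex subset of the plane with nonempty interior. -/
structure IsContour (C : Set Pt) : Prop where
  compact : IsCompact C
  convex : Convex ℝ C
  nonempty_interior : (interior C).Nonempty

/-- `t` is a topmost point of `C`. -/
def IsTopmost (C : Set Pt) (t : Pt) : Prop := t ∈ C ∧ ∀ q ∈ C, q.2 ≤ t.2

/-- The left chain of `C`: boundary points of minimal `x`-coordinate among the
points of `C` of the same `y`-coordinate. -/
def leftChain (C : Set Pt) : Set Pt :=
  {p | p ∈ C ∧ p ∈ frontier C ∧ ∀ q ∈ C, q.2 = p.2 → p.1 ≤ q.1}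

/-- The right chain of `C`: boundary points of maximal `x`-coordinate among the
points of `C` of the same `y`-coordinate. -/
def rightChain (C : Set Pt) : Set Pt :=
  {p | p ∈ C ∧ p ∈ frontier C ∧ ∀ q ∈ C, q.2 = p.2 → q.1 ≤ p.1}

/-- The sites are in general position: no three of them are collinear. -/
def GenPos (S : Finset Pt) : Prop :=
  ∀ a ∈ S, ∀ b ∈ S, ∀ c ∈ S, a ≠ b → b ≠ c → a ≠ c →
    ¬ Collinear ℝ ({a, b, c} : Set Pt)

/-- A label: a site, an axis-parallel closed rectangular text box (given by its
lower-left corner `lo` and upper-right corner `hi`), a port, and an orientation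
flag `isLeft` (`true` for a left label, `false` for a right label). -/
structure Label where
  site : Pt
  lo : Pt
  hi : Pt
  port : Pt
  isLeft : Bool

/-- The text box of a label, as a point set. -/
def Label.box (ℓ : Label) : Set Pt := Set.Icc ℓ.lo ℓ.hi

/-- The leader of a label: the closed segment from its site to its port. -/
def Label.leader (ℓ : Label) : Set Pt := segment ℝ ℓ.site ℓ.port

/-- A label as a point set: the union of its text box and its leader. -/
def Label.toSet (ℓ : Label) : Set Pt := ℓ.box ∪ ℓ.leader

/-- A valid label with respect to a contour `C`: nondegenerate box whose interior
is disjoint from `C`, port on the boundary of `C` and on the right (resp. left)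
edge of the text box for a left (resp. right) label (criterion T4), and leader
contained in `C`. -/
structure IsLabel (C : Set Pt) (ℓ : Label) : Prop where
  lo_le_hi : ℓ.lo ≤ ℓ.hi
  box_out : interior ℓ.box ∩ C = ∅
  port_bd : ℓ.port ∈ frontier C
  leader_in : ℓ.leader ⊆ C
  left_ok : ℓ.isLeft = true → ℓ.port.1 = ℓ.hi.1 ∧ ℓ.port.2 ∈ Set.Icc ℓ.lo.2 ℓ.hi.2
  right_ok : ℓ.isLeft = false → ℓ.port.1 = ℓ.lo.1 ∧ ℓ.port.2 ∈ Set.Icc ℓ.lo.2 ℓ.hi.2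

/-- The baseline of a label: the horizontal half-line emanating from the
bottom/top outer corner of the text box, away from the figure; a label is a top
label if the `y`-coordinate of its port is at least that of its site. -/
def Label.baseline (ℓ : Label) : Set Pt :=
  if ℓ.isLeft then
    (if ℓ.site.2 ≤ ℓ.port.2 then {p : Pt | p.2 = ℓ.hi.2 ∧ p.1 ≤ ℓ.lo.1}
     else {p : Pt | p.2 = ℓ.lo.2 ∧ p.1 ≤ ℓ.lo.1})
  else
    (if ℓ.site.2 ≤ ℓ.port.2 then {p : Pt | p.2 = ℓ.hi.2 ∧ ℓ.hi.1 ≤ p.1}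
     else {p : Pt | p.2 = ℓ.lo.2 ∧ ℓ.hi.1 ≤ p.1})

/-- Every left label has its port on the left chain and every right label has
its port on the right chain. -/
def PortsOnChains (C : Set Pt) (L : List Label) : Prop :=
  ∀ ℓ ∈ L, (ℓ.isLeft = true → ℓ.port ∈ leftChain C) ∧
           (ℓ.isLeft = false → ℓ.port ∈ rightChain C)

/-- `ChainPortOK C ℓ`: the port of `ℓ` lies on the chain matching its side. -/
def ChainPortOK (C : Set Pt) (ℓ : Label) : Prop :=
  (ℓ.isLeft = true → ℓ.port ∈ leftChain C) ∧ (ℓ.isLeft = false → ℓ.port ∈ rightChain C)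

/-- Clockwise order (from the topmost point) of two boundary points of `C` that
lie on its chains: the right chain is traversed top-down before the left chain
is traversed bottom-up. -/
def CwLT (C : Set Pt) (p q : Pt) : Prop :=
  (p ∈ rightChain C ∧ q ∈ rightChain C ∧ q.2 < p.2) ∨
  (p ∈ rightChain C ∧ q ∈ leftChain C ∧ q ∉ rightChain C) ∨
  (p ∉ rightChain C ∧ p ∈ leftChain C ∧ q ∈ leftChain C ∧ q ∉ rightChain C ∧ p.2 < q.2)

/-- A list of labels is in radial order if consecutive list entries have ports in
clockwise order along the boundary of `C`. -/
def InRadialOrder (C : Set Pt) (L : List Label) : Prop :=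
  L.Chain' (fun a b => CwLT C a.port b.port)

/-- A contour labeling of `(C, S)`, represented as the list of its labels in
radial order: exactly one valid label for each site of `S`. -/
structure IsContourLabeling (C : Set Pt) (S : Finset Pt) (L : List Label) : Prop where
  valid : ∀ ℓ ∈ L, IsLabel C ℓ
  nodup_sites : (L.map Label.site).Nodup
  sites_iff : ∀ s : Pt, s ∈ S ↔ s ∈ L.map Label.site
  radial : InRadialOrder C L

/-- A labeling is planar if its labels are pairwise disjoint point sets. -/
def PlanarList (L : List Label) : Prop :=
  L.Pairwise (fun a b => a.toSet ∩ b.toSet = ∅)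

/-- Two labels are consecutive in the cyclic radial ordering. -/
def Consecutive (L : List Label) (a b : Label) : Prop :=
  (a, b) ∈ L.zip (L.rotate 1) ∨ (b, a) ∈ L.zip (L.rotate 1)

/-- Staircase property (criterion T5): no label intersects the baseline of a
consecutive label. -/
def IsStaircase (L : List Label) : Prop :=
  ∀ a b, Consecutive L a b → a.toSet ∩ b.baseline = ∅ ∧ b.toSet ∩ a.baseline = ∅

/-- Assumption 1: no text box of any label intersects the convex hull of the sites. -/
def Assumption1 (S : Finset Pt) (L : List Label) : Prop :=
  ∀ ℓ ∈ L, ℓ.box ∩ convexHull ℝ (S : Set Pt) = ∅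

/-- No two leaders of the labeling intersect. -/
def LeadersDisjoint (L : List Label) : Prop :=
  L.Pairwise (fun a b => a.leader ∩ b.leader = ∅)

/-- No two consecutive labels of the labeling intersect. -/
def ConsecutiveDisjoint (L : List Label) : Prop :=
  ∀ a b, Consecutive L a b → a ≠ b → a.toSet ∩ b.toSet = ∅

/-- The (open) path cost of a list of labels:
`Σ c1(ℓ_i) + Σ c2(ℓ_i, ℓ_{i+1})` over consecutive pairs of the list. -/
def pathCost (c1 : Label → ℝ) (c2 : Label → Label → ℝ) (L : List Label) : ℝ :=
  (L.map c1).sum + (List.zipWith c2 L L.tail).sum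

/-- The cyclic cost of a labeling:
`Σ_{i=1}^n ( c1(ℓ_i) + c2(ℓ_i, ℓ_{i+1}) )` with `ℓ_{n+1} = ℓ_1`. -/
def cycCost (c1 : Label → ℝ) (c2 : Label → Label → ℝ) (L : List Label) : ℝ :=
  (L.map c1).sum + (List.zipWith c2 L (L.rotate 1)).sum

/-- The polyline through a list of points, as a point set. -/
def polyline : List Pt → Set Pt
  | [] => ∅
  | [a] => {a}
  | a :: b :: r => segment ℝ a b ∪ polyline (b :: r)

/-- A convex chain `(s_1, …, s_k)`: at least two pairwise distinct points that
appear in this order on the boundary of their convex hull (the hull lies to the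
left of each directed edge), the interior points lying strictly to the right of
the directed line from `s_1` to `s_k`. -/
def IsConvexChain (K : List Pt) : Prop :=
  2 ≤ K.length ∧ K.Nodup ∧
  (∀ ab ∈ K.zip K.tail, ∀ p ∈ K, LeftOrOn ab.1 ab.2 p) ∧
  (∀ p ∈ K, LeftOrOn K.getLast! K.head! p) ∧
  (∀ s ∈ (K.drop 1).dropLast, StrictRightOf K.head! K.getLast! s)

/-- A (candidate) sub-instance, given by its separator: the two fixed labels
`la` and `lb` and the convex chain `K` from the site of `la` to the site of `lb`. -/
structure SubInstance where
  la : Label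
  lb : Label
  K : List Pt

namespace SubInstance

/-- The separator `K' = (p_1, s_1, …, s_k, p_k)` as a point set. -/
def sepSet (J : SubInstance) : Set Pt :=
  J.la.leader ∪ polyline J.K ∪ J.lb.leader

/-- The interior sites `s_2, …, s_{k-1}` of the chain of the separator. -/
def innerSites (J : SubInstance) : Set Pt := {p | p ∈ (J.K.drop 1).dropLast}

/-- The region `C'` of the sub-instance: the part of `C` cut off by the
separator that does not contain the topmost point `t`. -/
def region (C : Set Pt) (t : Pt) (J : SubInstance) : Set Pt :=
  C \ connectedComponentIn (C \ J.sepSet) t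

/-- The region `C''`: the closed part of `C` on the side of the separator that
contains the topmost point `t` (the concave counterpart). -/
def regionTop (C : Set Pt) (t : Pt) (J : SubInstance) : Set Pt :=
  C ∩ closure (connectedComponentIn (C \ J.sepSet) t)

/-- The sites belonging to the sub-instance: the sites of `S` in its region,
other than the sites of the two separator labels. -/
def sites (C : Set Pt) (t : Pt) (S : Finset Pt) (J : SubInstance) : Set Pt :=
  {s | s ∈ (S : Set Pt) ∧ s ∈ J.region C t ∧ s ≠ J.la.site ∧ s ≠ J.lb.site}

/-- Region `A_1` of the concave part `C''`: the part of `C''` strictly to the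
left of the line from `s_1` to `s_k` that is adjacent to the leader of `la`. -/
def A1 (C : Set Pt) (t : Pt) (J : SubInstance) : Set Pt :=
  {p | p ∈ J.regionTop C t ∧ StrictLeftOf J.la.site J.lb.site p ∧
    (closure (connectedComponentIn
        (J.regionTop C t ∩ {q | StrictLeftOf J.la.site J.lb.site q}) p)
      ∩ J.la.leader).Nonempty}

/-- Region `A_3` of the concave part `C''`: the part of `C''` strictly to the
left of the line from `s_1` to `s_k` that is adjacent to the leader of `lb`. -/
def A3 (C : Set Pt) (t : Pt) (J : SubInstance) : Set Pt :=
  {p | p ∈ J.regionTop C t ∧ StrictLeftOf J.la.site J.lb.site p ∧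
    (closure (connectedComponentIn
        (J.regionTop C t ∩ {q | StrictLeftOf J.la.site J.lb.site q}) p)
      ∩ J.lb.leader).Nonempty}

/-- Region `A_2` of the concave part `C''`: the part strictly to the right of
the line from `s_1` to `s_k`. -/
def A2 (C : Set Pt) (t : Pt) (J : SubInstance) : Set Pt :=
  {p | p ∈ J.regionTop C t ∧ StrictRightOf J.la.site J.lb.site p}

/-- For a capstone instance: the part `A_1` of the region of the instance
strictly to the right of the line from `s_1` to `s_2`, adjacent to the leader
of `la`. -/
def A1cap (C : Set Pt) (t : Pt) (J : SubInstance) : Set Pt :=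
  {p | p ∈ J.region C t ∧ StrictRightOf J.la.site J.lb.site p ∧
    (closure (connectedComponentIn
        (J.region C t ∩ {q | StrictRightOf J.la.site J.lb.site q}) p)
      ∩ J.la.leader).Nonempty}

/-- For a capstone instance: the part `A_3` of the region of the instance
strictly to the right of the line from `s_1` to `s_2`, adjacent to the leader
of `lb`. -/
def A3cap (C : Set Pt) (t : Pt) (J : SubInstance) : Set Pt :=
  {p | p ∈ J.region C t ∧ StrictRightOf J.la.site J.lb.site p ∧
    (closure (connectedComponentIn
        (J.region C t ∩ {q | StrictRightOf J.la.site J.lb.site q}) p)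
      ∩ J.lb.leader).Nonempty}

/-- For a capstone instance: the part `A_2` of the region of the instance
strictly to the left of the line from `s_1` to `s_2`. -/
def A2cap (C : Set Pt) (t : Pt) (J : SubInstance) : Set Pt :=
  {p | p ∈ J.region C t ∧ StrictLeftOf J.la.site J.lb.site p}

end SubInstance

/-- Well-formedness of a separator: the two labels are valid, satisfy T4 with
ports on the correct chains, are disjoint, the chain is convex and runs from the
site of `la` to the site of `lb`, and the port of `la` is met before the port
of `lb` when traversing the boundary clockwise from the topmost point. -/
structure IsSeparator (C : Set Pt) (t : Pt) (J : SubInstance) : Prop where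
  la_valid : IsLabel C J.la
  lb_valid : IsLabel C J.lb
  la_chain : ChainPortOK C J.la
  lb_chain : ChainPortOK C J.lb
  disj : J.la.toSet ∩ J.lb.toSet = ∅
  chain : IsConvexChain J.K
  head_eq : J.K.head? = some J.la.site
  last_eq : J.K.getLast? = some J.lb.site
  order : CwLT C J.la.port J.lb.port

/-- A label is contained in a sub-instance if its leader lies in the region of
the sub-instance and meets the separator at most in the interior chain sites,
and its port lies on the part of the boundary of `C` belonging to the
sub-instance. -/
def ContainedIn (C : Set Pt) (t : Pt) (J : SubInstance) (ℓ : Label) : Prop :=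
  ℓ.leader ⊆ J.region C t ∧
  ℓ.leader ∩ J.sepSet ⊆ J.innerSites ∧
  ℓ.port ∈ frontier C ∧ ℓ.port ∈ J.region C t

/-- The restriction `L|J` of a radially ordered labeling `L` to a sub-instance
`J`: the labels of `L` contained in `J`, together with the two separator labels
of `J`, in radial order. -/
def restrict (C : Set Pt) (t : Pt) (L : List Label) (J : SubInstance) : List Label :=
  J.la :: (L.filter (fun ℓ => decide (ContainedIn C t J ℓ)) ++ [J.lb])

/-- A planar labeling of a convex instance `J`: the two fixed separator labels
(first and last in radial order) together with exactly one label for each site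
of the instance, pairwise disjoint, each contained in the instance. -/
structure IsInstanceLabeling (C : Set Pt) (t : Pt) (S : Finset Pt)
    (J : SubInstance) (L : List Label) : Prop where
  sep : IsSeparator C t J
  head_eq : L.head? = some J.la
  last_eq : L.getLast? = some J.lb
  valid : ∀ ℓ ∈ L, IsLabel C ℓ
  contained : ∀ ℓ ∈ L, ℓ ≠ J.la → ℓ ≠ J.lb → ContainedIn C t J ℓ
  nodup_sites : (L.map Label.site).Nodup
  sites_iff : ∀ s : Pt, s ∈ J.sites C t S ↔ ∃ ℓ ∈ L, ℓ ≠ J.la ∧ ℓ ≠ J.lb ∧ ℓ.site = s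
  planar : PlanarList L
  radial : InRadialOrder C L

/-- `W` separates `A` from `B` inside the ambient set `amb`: no connected subset
of `amb \ W` meets both `A` and `B`. -/
def SeparatesIn (amb W A B : Set Pt) : Prop :=
  ∀ a ∈ A \ W, ∀ b ∈ B \ W, b ∉ connectedComponentIn (amb \ W) a

/-- The convex instance `J` has type A with support point `s`: `s` is a site in
region `A_1` such that the label `la` together with the half-line emanating from
`s` through the site of `la` separates the chain `K` from the sites in the
concave part `C''`. -/
def IsTypeA (C : Set Pt) (t : Pt) (S : Finset Pt) (J : SubInstance) (s : Pt) : Prop :=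
  s ∈ (S : Set Pt) ∧ s ∈ J.A1 C t ∧
  SeparatesIn C (J.la.toSet ∪ halfLine s J.la.site)
    {p | p ∈ J.K} ((S : Set Pt) ∩ J.regionTop C t)

/-- The convex instance `J` has type B with support point `s`: `s` is a site in
region `A_3` such that the label `lb` together with the half-line emanating from
`s` through the site of `lb` separates the chain `K` from the sites in the
concave part `C''`. -/
def IsTypeB (C : Set Pt) (t : Pt) (S : Finset Pt) (J : SubInstance) (s : Pt) : Prop :=
  s ∈ (S : Set Pt) ∧ s ∈ J.A3 C t ∧
  SeparatesIn C (J.lb.toSet ∪ halfLine s J.lb.site)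
    {p | p ∈ J.K} ((S : Set Pt) ∩ J.regionTop C t)

/-- The concave part `C''` of the instance contains no sites (besides the chain
sites themselves); this is the case of support point `⊥`. -/
def ConcaveEmpty (C : Set Pt) (t : Pt) (S : Finset Pt) (J : SubInstance) : Prop :=
  (S : Set Pt) ∩ J.regionTop C t ⊆ {p | p ∈ J.K}

/-- A capstone instance: the chain consists only of the two separator sites. -/
def IsCapstone (J : SubInstance) : Prop :=
  J.K = [J.la.site, J.lb.site]

/-- Two sub-instances are disjoint if the interiors of their regions are disjoint. -/
def InstancesDisjoint (C : Set Pt) (t : Pt) (J J' : SubInstance) : Prop :=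
  interior (J.region C t) ∩ interior (J'.region C t) = ∅

end


section StaircaseCore

def SSeg (a b z : Pt) : Prop :=
  ∃ t : ℝ, 0 ≤ t ∧ t ≤ 1 ∧ z = (a.1 + t * (b.1 - a.1), a.2 + t * (b.2 - a.2))

def OSeg (a b z : Pt) : Prop :=
  ∃ t : ℝ, 0 < t ∧ t < 1 ∧ z = (a.1 + t * (b.1 - a.1), a.2 + t * (b.2 - a.2))

structure BLab where
  s : Pt
  p : Pt
  a : ℝ
  b : ℝ
  lo : ℝ
  hi : ℝ
  bl : ℝ
  left : Bool

def BLab.inBox (l : BLab) (z : Pt) : Prop := l.a ≤ z.1 ∧ z.1 ≤ l.b ∧ l.lo ≤ z.2 ∧ z.2 ≤ l.hi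

def BLab.base (l : BLab) (z : Pt) : Prop :=
  z.2 = l.bl ∧ ((l.left = true ∧ z.1 ≤ l.a) ∨ (l.left = false ∧ l.b ≤ z.1))

def BLab.inT (l : BLab) (z : Pt) : Prop := l.inBox z ∨ SSeg l.s l.p z

structure Sys {ι : Type} (C I : Set Pt) (l : ι → BLab) (adj : ι → ι → Prop) : Prop where
  conv : ∀ a ∈ C, ∀ b ∈ C, ∀ z, SSeg a b z → z ∈ C
  IC : ∀ z ∈ I, z ∈ C
  Iseg : ∀ s ∈ I, ∀ u ∈ C, ∀ z, OSeg s u z → z ∈ I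
  Il : ∀ s ∈ I, ∃ u ∈ C, u.2 = s.2 ∧ u.1 < s.1
  Ir : ∀ s ∈ I, ∃ u ∈ C, u.2 = s.2 ∧ s.1 < u.1
  xmin : ∃ w ∈ C, ∀ u ∈ C, w.1 ≤ u.1
  xmax : ∃ w ∈ C, ∀ u ∈ C, u.1 ≤ w.1
  sI : ∀ i, (l i).s ∈ I
  pC : ∀ i, (l i).p ∈ C
  pI : ∀ i, (l i).p ∉ I
  ab : ∀ i, (l i).a ≤ (l i).b
  lp : ∀ i, (l i).lo ≤ (l i).p.2
  ph : ∀ i, (l i).p.2 ≤ (l i).hi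
  hl : ∀ i, (l i).left = true → (l i).p.1 = (l i).b ∧ ∀ u ∈ C, u.2 = (l i).p.2 → (l i).p.1 ≤ u.1
  hr : ∀ i, (l i).left = false → (l i).p.1 = (l i).a ∧ ∀ u ∈ C, u.2 = (l i).p.2 → u.1 ≤ (l i).p.1
  out : ∀ i, ∀ u ∈ C, (l i).a < u.1 → u.1 < (l i).b → (l i).lo < u.2 → u.2 < (l i).hi → False
  hbl : ∀ i, ((l i).bl = (l i).hi ∧ (l i).s.2 ≤ (l i).p.2) ∨ ((l i).bl = (l i).lo ∧ (l i).p.2 ≤ (l i).s.2)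
  lead : ∀ i j, i ≠ j → ∀ z, SSeg (l i).s (l i).p z → SSeg (l j).s (l j).p z → False
  hull : ∀ i j k, ∀ z, SSeg (l j).s (l k).s z → (l i).inBox z → False
  adjs : ∀ i j, adj i j → adj j i
  adjn : ∀ i j, adj i j → i ≠ j
  adjd : ∀ i j, adj i j → ∀ z, (l i).inT z → (l j).inT z → False
  adjb : ∀ i j, adj i j → ∀ z, (l i).base z → (l j).inT z → False
  F : ∀ i j, i ≠ j → ¬ adj i j → ∃ b b', adj i b ∧ adj i b' ∧
    ((0 < cross2 (l i).p (l j).p (l b).p ∧ cross2 (l i).p (l j).p (l b').p < 0) ∨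
     (OSeg (l i).p (l j).p (l b).p ∧ ¬ OSeg (l i).p (l j).p (l b').p))

def mx (u : Pt) : Pt := (-u.1, u.2)
def my (u : Pt) : Pt := (u.1, -u.2)

@[simp] lemma mx_1 (u : Pt) : (mx u).1 = -u.1 := rfl
@[simp] lemma mx_2 (u : Pt) : (mx u).2 = u.2 := rfl
@[simp] lemma my_1 (u : Pt) : (my u).1 = u.1 := rfl
@[simp] lemma my_2 (u : Pt) : (my u).2 = -u.2 := rfl
@[simp] lemma mx_mx (u : Pt) : mx (mx u) = u := by simp [mx]
@[simp] lemma my_my (u : Pt) : my (my u) = u := by simp [my]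

def BLab.mX (l : BLab) : BLab := ⟨mx l.s, mx l.p, -l.b, -l.a, l.lo, l.hi, l.bl, !l.left⟩
def BLab.mY (l : BLab) : BLab := ⟨my l.s, my l.p, l.a, l.b, -l.hi, -l.lo, -l.bl, l.left⟩

lemma sseg_mx {a b z : Pt} (h : SSeg (mx a) (mx b) z) : SSeg a b (mx z) := by
  obtain ⟨t, h0, h1, rfl⟩ := h
  refine ⟨t, h0, h1, ?_⟩
  ext <;> simp; ring

lemma sseg_my {a b z : Pt} (h : SSeg (my a) (my b) z) : SSeg a b (my z) := by
  obtain ⟨t, h0, h1, rfl⟩ := h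
  refine ⟨t, h0, h1, ?_⟩
  ext <;> simp; ring

lemma oseg_mx {a b z : Pt} (h : OSeg (mx a) (mx b) z) : OSeg a b (mx z) := by
  obtain ⟨t, h0, h1, rfl⟩ := h
  refine ⟨t, h0, h1, ?_⟩
  ext <;> simp; ring

lemma oseg_my {a b z : Pt} (h : OSeg (my a) (my b) z) : OSeg a b (my z) := by
  obtain ⟨t, h0, h1, rfl⟩ := h
  refine ⟨t, h0, h1, ?_⟩
  ext <;> simp; ring

lemma inBox_mX {l : BLab} {z : Pt} (h : l.mX.inBox z) : l.inBox (mx z) := by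
  obtain ⟨h1, h2, h3, h4⟩ := h
  simp only [BLab.mX] at h1 h2 h3 h4
  refine ⟨?_, ?_, ?_, ?_⟩ <;> simp <;> linarith

lemma inBox_mY {l : BLab} {z : Pt} (h : l.mY.inBox z) : l.inBox (my z) := by
  obtain ⟨h1, h2, h3, h4⟩ := h
  simp only [BLab.mY] at h1 h2 h3 h4
  refine ⟨?_, ?_, ?_, ?_⟩ <;> simp <;> linarith

lemma mX_mX (l : BLab) : l.mX.mX = l := by simp [BLab.mX]
lemma mY_mY (l : BLab) : l.mY.mY = l := by simp [BLab.mY]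

lemma inBox_mX' {l : BLab} {z : Pt} (h : l.inBox z) : l.mX.inBox (mx z) := by
  apply inBox_mX; rw [mX_mX]; exact h

lemma inBox_mY' {l : BLab} {z : Pt} (h : l.inBox z) : l.mY.inBox (my z) := by
  apply inBox_mY; rw [mY_mY]; exact h

lemma inT_mX {l : BLab} {z : Pt} (h : l.mX.inT z) : l.inT (mx z) := by
  rcases h with h | h
  · exact Or.inl (inBox_mX h)
  · exact Or.inr (sseg_mx h)

lemma inT_mY {l : BLab} {z : Pt} (h : l.mY.inT z) : l.inT (my z) := by
  rcases h with h | h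
  · exact Or.inl (inBox_mY h)
  · exact Or.inr (sseg_my h)

lemma base_mX {l : BLab} {z : Pt} (h : l.mX.base z) : l.base (mx z) := by
  obtain ⟨h1, h2⟩ := h
  simp only [BLab.mX] at h1 h2
  refine ⟨by simpa using h1, ?_⟩
  rcases h2 with ⟨h2, h3⟩ | ⟨h2, h3⟩
  · right; exact ⟨by simpa using h2, by simp; linarith⟩
  · left; exact ⟨by simpa using h2, by simp; linarith⟩

lemma base_mY {l : BLab} {z : Pt} (h : l.mY.base z) : l.base (my z) := by
  obtain ⟨h1, h2⟩ := h
  simp only [BLab.mY] at h1 h2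
  refine ⟨by simp; linarith, ?_⟩
  rcases h2 with ⟨h2, h3⟩ | ⟨h2, h3⟩
  · left; exact ⟨by simpa using h2, by simp; linarith⟩
  · right; exact ⟨by simpa using h2, by simp; linarith⟩

lemma cross2_mx (a b p : Pt) : cross2 (mx a) (mx b) (mx p) = - cross2 a b p := by
  simp [cross2]; ring
lemma cross2_my (a b p : Pt) : cross2 (my a) (my b) (my p) = - cross2 a b p := by
  simp [cross2]; ring

variable {ι : Type} {C I : Set Pt} {l : ι → BLab} {adj : ι → ι → Prop}

theorem Sys.mX (S : Sys C I l adj) :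
    Sys {u | mx u ∈ C} {u | mx u ∈ I} (fun i => (l i).mX) adj where
  conv a ha b hb z hz := S.conv _ ha _ hb _ (sseg_mx (by simpa using hz))
  IC z hz := S.IC _ hz
  Iseg a ha b hb z hz := S.Iseg _ ha _ hb _ (oseg_mx (by simpa using hz))
  Il s hs := by
    obtain ⟨u, h1, h2, h3⟩ := S.Ir _ hs
    exact ⟨mx u, by simpa using h1, by simpa using h2, by simp at h3 ⊢; linarith⟩
  Ir s hs := by
    obtain ⟨u, h1, h2, h3⟩ := S.Il _ hs
    exact ⟨mx u, by simpa using h1, by simpa using h2, by simp at h3 ⊢; linarith⟩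
  xmin := by
    obtain ⟨w, h1, h2⟩ := S.xmax
    exact ⟨mx w, by simpa using h1, fun u hu => by have := h2 _ hu; simp at this ⊢; linarith⟩
  xmax := by
    obtain ⟨w, h1, h2⟩ := S.xmin
    exact ⟨mx w, by simpa using h1, fun u hu => by have := h2 _ hu; simp at this ⊢; linarith⟩
  sI i := by simpa [BLab.mX] using S.sI i
  pC i := by simpa [BLab.mX] using S.pC i
  pI i := by simpa [BLab.mX] using S.pI i
  ab i := by simpa [BLab.mX] using S.ab i
  lp i := by simpa [BLab.mX] using S.lp i
  ph i := by simpa [BLab.mX] using S.ph i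
  hl i h := by
    have := S.hr i (by simpa [BLab.mX] using h)
    refine ⟨by simpa [BLab.mX] using this.1, fun u hu h2 => ?_⟩
    have := this.2 _ hu (by simpa [BLab.mX] using h2)
    simp [BLab.mX] at this ⊢; linarith
  hr i h := by
    have := S.hl i (by simpa [BLab.mX] using h)
    refine ⟨by simpa [BLab.mX] using this.1, fun u hu h2 => ?_⟩
    have := this.2 _ hu (by simpa [BLab.mX] using h2)
    simp [BLab.mX] at this ⊢; linarith
  out i u hu h1 h2 h3 h4 := by
    simp [BLab.mX] at h1 h2 h3 h4
    exact S.out i _ hu (by simp; linarith) (by simp; linarith) (by simp; linarith) (by simp; linarith)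
  hbl i := by simpa [BLab.mX] using S.hbl i
  lead i j hij z h1 h2 := S.lead i j hij _ (sseg_mx h1) (sseg_mx h2)
  hull i j k z h1 h2 := S.hull i j k _ (sseg_mx h1) (inBox_mX h2)
  adjs := S.adjs
  adjn := S.adjn
  adjd i j h z h1 h2 := S.adjd i j h _ (inT_mX h1) (inT_mX h2)
  adjb i j h z h1 h2 := S.adjb i j h _ (base_mX h1) (inT_mX h2)
  F i j hij hn := by
    obtain ⟨b, b', h1, h2, h3⟩ := S.F i j hij hn
    rcases h3 with ⟨h3, h4⟩ | ⟨h3, h4⟩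
    · refine ⟨b', b, h2, h1, Or.inl ⟨?_, ?_⟩⟩ <;> simp only [BLab.mX, cross2_mx] <;> linarith
    · refine ⟨b, b', h1, h2, Or.inr ⟨?_, ?_⟩⟩
      · exact (oseg_mx (a := mx (l i).p) (b := mx (l j).p) (by simpa using h3))
      · intro h; apply h4
        have := oseg_mx (a := (l i).p) (b := (l j).p) h
        simpa [BLab.mX] using this

theorem Sys.mY (S : Sys C I l adj) :
    Sys {u | my u ∈ C} {u | my u ∈ I} (fun i => (l i).mY) adj where
  conv a ha b hb z hz := S.conv _ ha _ hb _ (sseg_my (by simpa using hz))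
  IC z hz := S.IC _ hz
  Iseg a ha b hb z hz := S.Iseg _ ha _ hb _ (oseg_my (by simpa using hz))
  Il s hs := by
    obtain ⟨u, h1, h2, h3⟩ := S.Il _ hs
    exact ⟨my u, by simpa using h1, by simp [h2], by simpa using h3⟩
  Ir s hs := by
    obtain ⟨u, h1, h2, h3⟩ := S.Ir _ hs
    exact ⟨my u, by simpa using h1, by simp [h2], by simpa using h3⟩
  xmin := by
    obtain ⟨w, h1, h2⟩ := S.xmin
    exact ⟨my w, by simpa using h1, fun u hu => by have := h2 _ hu; simpa using this⟩
  xmax := by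
    obtain ⟨w, h1, h2⟩ := S.xmax
    exact ⟨my w, by simpa using h1, fun u hu => by have := h2 _ hu; simpa using this⟩
  sI i := by simpa [BLab.mY] using S.sI i
  pC i := by simpa [BLab.mY] using S.pC i
  pI i := by simpa [BLab.mY] using S.pI i
  ab i := by simpa [BLab.mY] using S.ab i
  lp i := by simpa [BLab.mY] using S.ph i
  ph i := by simpa [BLab.mY] using S.lp i
  hl i h := by
    have := S.hl i (by simpa [BLab.mY] using h)
    refine ⟨by simpa [BLab.mY] using this.1, fun u hu h2 => ?_⟩
    have := this.2 _ hu (by simp [BLab.mY] at h2 ⊢; linarith)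
    simpa [BLab.mY] using this
  hr i h := by
    have := S.hr i (by simpa [BLab.mY] using h)
    refine ⟨by simpa [BLab.mY] using this.1, fun u hu h2 => ?_⟩
    have := this.2 _ hu (by simp [BLab.mY] at h2 ⊢; linarith)
    simpa [BLab.mY] using this
  out i u hu h1 h2 h3 h4 := by
    simp [BLab.mY] at h1 h2 h3 h4
    exact S.out i _ hu (by simp; linarith) (by simp; linarith) (by simp; linarith) (by simp; linarith)
  hbl i := by
    have := S.hbl i
    simp [BLab.mY]; tauto
  lead i j hij z h1 h2 := S.lead i j hij _ (sseg_my h1) (sseg_my h2)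
  hull i j k z h1 h2 := S.hull i j k _ (sseg_my h1) (inBox_mY h2)
  adjs := S.adjs
  adjn := S.adjn
  adjd i j h z h1 h2 := S.adjd i j h _ (inT_mY h1) (inT_mY h2)
  adjb i j h z h1 h2 := S.adjb i j h _ (base_mY h1) (inT_mY h2)
  F i j hij hn := by
    obtain ⟨b, b', h1, h2, h3⟩ := S.F i j hij hn
    rcases h3 with ⟨h3, h4⟩ | ⟨h3, h4⟩
    · refine ⟨b', b, h2, h1, Or.inl ⟨?_, ?_⟩⟩ <;> simp only [BLab.mY, cross2_my] <;> linarith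
    · refine ⟨b, b', h1, h2, Or.inr ⟨?_, ?_⟩⟩
      · exact (oseg_my (a := my (l i).p) (b := my (l j).p) (by simpa using h3))
      · intro h; apply h4
        have := oseg_my (a := (l i).p) (b := (l j).p) h
        simpa [BLab.mY] using this

end StaircaseCore

section StaircaseCore2

lemma sseg_l (a b : Pt) : SSeg a b a := ⟨0, le_rfl, zero_le_one, by ext <;> simp⟩
lemma sseg_r (a b : Pt) : SSeg a b b := ⟨1, zero_le_one, le_rfl, by ext <;> simp⟩

lemma sseg_symm {a b z : Pt} (h : SSeg a b z) : SSeg b a z := by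
  obtain ⟨t, h0, h1, rfl⟩ := h
  refine ⟨1 - t, by linarith, by linarith, ?_⟩
  ext <;> simp <;> ring

lemma oseg_symm {a b z : Pt} (h : OSeg a b z) : OSeg b a z := by
  obtain ⟨t, h0, h1, rfl⟩ := h
  refine ⟨1 - t, by linarith, by linarith, ?_⟩
  ext <;> simp <;> ring

lemma oseg_sseg {a b z : Pt} (h : OSeg a b z) : SSeg a b z := by
  obtain ⟨t, h0, h1, rfl⟩ := h
  exact ⟨t, h0.le, h1.le, rfl⟩

lemma sseg_sub {a b y z x : Pt} (h1 : SSeg a b y) (h2 : SSeg a b z) (h3 : SSeg y z x) :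
    SSeg a b x := by
  obtain ⟨t, t0, t1, rfl⟩ := h1
  obtain ⟨r, r0, r1, rfl⟩ := h2
  obtain ⟨q, q0, q1, rfl⟩ := h3
  refine ⟨t + q * (r - t), by nlinarith, by nlinarith, ?_⟩
  ext <;> simp <;> ring

lemma sseg_x {a b : Pt} {c : ℝ} (h : (a.1 - c) * (b.1 - c) ≤ 0) : ∃ z, SSeg a b z ∧ z.1 = c := by
  by_cases hab : a.1 = b.1
  · refine ⟨a, sseg_l a b, ?_⟩
    rw [← hab] at h
    nlinarith [sq_nonneg (a.1 - c), pow_eq_zero_iff (two_ne_zero) (a := a.1 - c),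
      show a.1 - c = 0 by nlinarith [mul_self_eq_zero.1 (le_antisymm h (mul_self_nonneg (a.1 - c)))]]
  · have hne : b.1 - a.1 ≠ 0 := fun h => hab (by linarith)
    have e : (c - a.1) / (b.1 - a.1) * (b.1 - a.1) = c - a.1 := div_mul_cancel₀ _ hne
    refine ⟨_, ⟨(c - a.1) / (b.1 - a.1), ?_, ?_, rfl⟩, by simp [e]⟩
    · rcases lt_or_gt_of_ne hne with hlt | hgt
      · apply div_nonneg_of_nonpos _ hlt.le
        by_contra hc; push Not at hc; nlinarith
      · apply div_nonneg _ hgt.le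
        by_contra hc; push Not at hc; nlinarith
    · rcases lt_or_gt_of_ne hne with hlt | hgt
      · rw [div_le_one_of_neg hlt]
        by_contra hc; push Not at hc; nlinarith
      · rw [div_le_one hgt]
        by_contra hc; push Not at hc; nlinarith

lemma sseg_swap {a b z : Pt} (h : SSeg a b z) : SSeg (a.2, a.1) (b.2, b.1) (z.2, z.1) := by
  obtain ⟨t, h0, h1, rfl⟩ := h
  exact ⟨t, h0, h1, rfl⟩

lemma sseg_y {a b : Pt} {c : ℝ} (h : (a.2 - c) * (b.2 - c) ≤ 0) : ∃ z, SSeg a b z ∧ z.2 = c := by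
  obtain ⟨z, hz, hc⟩ := sseg_x (a := (a.2, a.1)) (b := (b.2, b.1)) (c := c) h
  exact ⟨(z.2, z.1), sseg_swap hz, hc⟩

/-- convexity bounds along segments -/
lemma sseg_x_le {a b z : Pt} (h : SSeg a b z) {m : ℝ} (ha : a.1 ≤ m) (hb : b.1 ≤ m) : z.1 ≤ m := by
  obtain ⟨t, h0, h1, rfl⟩ := h
  simp only; nlinarith
lemma sseg_le_x {a b z : Pt} (h : SSeg a b z) {m : ℝ} (ha : m ≤ a.1) (hb : m ≤ b.1) : m ≤ z.1 := by
  obtain ⟨t, h0, h1, rfl⟩ := h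
  simp only; nlinarith
lemma sseg_y_le {a b z : Pt} (h : SSeg a b z) {m : ℝ} (ha : a.2 ≤ m) (hb : b.2 ≤ m) : z.2 ≤ m :=
  sseg_x_le (sseg_swap h) (m := m) ha hb
lemma sseg_y_lt {a b z : Pt} (h : SSeg a b z) {m : ℝ} (ha : a.2 < m) (hb : b.2 < m) : z.2 < m := by
  have := sseg_y_le h (le_max_left a.2 b.2) (le_max_right a.2 b.2)
  exact lt_of_le_of_lt this (max_lt ha hb)

variable {ι : Type} {C I : Set Pt} {l : ι → BLab} {adj : ι → ι → Prop}

def CConv (C : Set Pt) : Prop := ∀ a ∈ C, ∀ b ∈ C, ∀ z, SSeg a b z → z ∈ C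

lemma LM (hC : CConv C) {p u v : Pt} (hp : ∀ x ∈ C, x.2 = p.2 → p.1 ≤ x.1)
    (hu : u ∈ C) (hv : v ∈ C) (h1 : u.2 ≤ p.2) (h2 : p.2 ≤ v.2) (h3 : u.2 < v.2) :
    0 ≤ cross2 u v p := by
  have hpos : 0 < v.2 - u.2 := by linarith
  have e : (p.2 - u.2) / (v.2 - u.2) * (v.2 - u.2) = p.2 - u.2 := div_mul_cancel₀ _ hpos.ne'
  set t := (p.2 - u.2) / (v.2 - u.2) with ht
  have t0 : 0 ≤ t := div_nonneg (by linarith) hpos.le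
  have t1 : t ≤ 1 := by rw [ht, div_le_one hpos]; linarith
  have := hp _ (hC u hu v hv _ ⟨t, t0, t1, rfl⟩) (by simp [e])
  simp only at this
  unfold cross2
  have h4 := mul_le_mul_of_nonneg_right this hpos.le
  have : (u.1 + t * (v.1 - u.1)) * (v.2 - u.2) = u.1 * (v.2 - u.2) + (v.1 - u.1) * (t * (v.2 - u.2)) := by ring
  rw [this, e] at h4
  linarith

lemma RM (hC : CConv C) {p u v : Pt} (hp : ∀ x ∈ C, x.2 = p.2 → x.1 ≤ p.1)
    (hu : u ∈ C) (hv : v ∈ C) (h1 : u.2 ≤ p.2) (h2 : p.2 ≤ v.2) (h3 : u.2 < v.2) :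
    cross2 u v p ≤ 0 := by
  have := LM (C := {u | mx u ∈ C}) (p := mx p) (u := mx u) (v := mx v)
    (fun a ha b hb z hz => hC _ ha _ hb _ (sseg_mx (by simpa using hz)))
    (fun x hx h => by have := hp _ hx (by simpa using h); simp at this ⊢; linarith)
    (by simpa using hu) (by simpa using hv) h1 h2 h3
  rw [cross2_mx] at this
  linarith

/-- leftmost, strict contradiction form -/
lemma LMs (hC : CConv C) {p u v : Pt} (hp : ∀ x ∈ C, x.2 = p.2 → p.1 ≤ x.1)
    (hu : u ∈ C) (hv : v ∈ C) (h1 : u.1 < p.1) (h2 : v.1 ≤ p.1)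
    (h3 : (u.2 - p.2) * (v.2 - p.2) ≤ 0) (h4 : v.2 ≠ p.2) : False := by
  rcases lt_or_gt_of_ne h4 with h | h
  · have h5 : p.2 ≤ u.2 := by by_contra hc; push Not at hc; nlinarith
    have := LM hC hp hv hu h.le h5 (by linarith)
    unfold cross2 at this
    nlinarith
  · have h5 : u.2 ≤ p.2 := by by_contra hc; push Not at hc; nlinarith
    have := LM hC hp hu hv h5 h.le (by linarith)
    unfold cross2 at this
    nlinarith

lemma RMs (hC : CConv C) {p u v : Pt} (hp : ∀ x ∈ C, x.2 = p.2 → x.1 ≤ p.1)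
    (hu : u ∈ C) (hv : v ∈ C) (h1 : p.1 < u.1) (h2 : p.1 ≤ v.1)
    (h3 : (u.2 - p.2) * (v.2 - p.2) ≤ 0) (h4 : v.2 ≠ p.2) : False := by
  refine LMs (C := {u | mx u ∈ C}) (p := mx p) (u := mx u) (v := mx v)
    (fun a ha b hb z hz => hC _ ha _ hb _ (sseg_mx (by simpa using hz)))
    (fun x hx h => by have := hp _ hx (by simpa using h); simp at this ⊢; linarith)
    (by simpa using hu) (by simpa using hv) ?_ ?_ h3 h4
  · simp; linarith
  · simp; linarith

lemma Sys.cc (S : Sys C I l adj) : CConv C := S.conv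

/-- K1 -/
lemma Sys.K1 (S : Sys C I l adj) {i : ι} (hL : (l i).left = true) (hw : (l i).a < (l i).b)
    (hh : (l i).p.2 < (l i).hi) {u : Pt} (hu : u ∈ C) (h2 : (l i).p.2 < u.2)
    (h1 : u.1 < (l i).p.1) : False := by
  have hb := (S.hl i hL).1
  have hlp := S.lp i
  set p := (l i).p with hp
  obtain ⟨τ, t0, t1, e1, e2⟩ : ∃ τ : ℝ, 0 < τ ∧ τ ≤ 1 ∧ τ * (p.1 - u.1) < p.1 - (l i).a ∧
      τ * (u.2 - p.2) < (l i).hi - p.2 := by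
    have q1 : 0 < p.1 - u.1 := by linarith
    have q2 : 0 < u.2 - p.2 := by linarith
    have q3 : 0 < p.1 - (l i).a := by linarith
    have q4 : 0 < (l i).hi - p.2 := by linarith
    refine ⟨min 1 (min ((p.1 - (l i).a) / (2 * (p.1 - u.1))) (((l i).hi - p.2) / (2 * (u.2 - p.2)))),
      by positivity, min_le_left _ _, ?_, ?_⟩
    · calc _ ≤ ((p.1 - (l i).a) / (2 * (p.1 - u.1))) * (p.1 - u.1) := by
            apply mul_le_mul_of_nonneg_right _ q1.le
            exact (min_le_right _ _).trans (min_le_left _ _)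
        _ = (p.1 - (l i).a) / 2 := by field_simp
        _ < _ := by linarith
    · calc _ ≤ (((l i).hi - p.2) / (2 * (u.2 - p.2))) * (u.2 - p.2) := by
            apply mul_le_mul_of_nonneg_right _ q2.le
            exact (min_le_right _ _).trans (min_le_right _ _)
        _ = ((l i).hi - p.2) / 2 := by field_simp
        _ < _ := by linarith
  have m1 : 0 < τ * (p.1 - u.1) := mul_pos t0 (by linarith)
  have m2 : 0 < τ * (u.2 - p.2) := mul_pos t0 (by linarith)
  refine S.out i _ (S.conv p (S.pC i) u hu _ ⟨τ, t0.le, t1, rfl⟩) ?_ ?_ ?_ ?_ <;> simp only <;> linarith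

lemma Sys.K2 (S : Sys C I l adj) {i : ι} (hL : (l i).left = true) (hw : (l i).a < (l i).b)
    (hh : (l i).lo < (l i).p.2) {u : Pt} (hu : u ∈ C) (h2 : u.2 < (l i).p.2)
    (h1 : u.1 < (l i).p.1) : False :=
  S.mY.K1 (i := i) hL hw (by simpa [BLab.mY] using hh) (u := my u) (by simpa using hu)
    (by simpa [BLab.mY] using h2) h1

/-- ALC -/
lemma Sys.ALC (S : Sys C I l adj) {i j : ι} (hL : (l i).left = true) (hadj : adj i j)
    (h1 : (l i).p.2 < (l j).p.2) (h2 : (l j).p.2 < (l i).hi) (h3 : (l j).p.1 < (l i).p.1)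
    (hb : (l i).bl = (l i).hi) (hs : (l i).s.2 ≤ (l i).p.2) : False := by
  obtain ⟨hpb, hlm⟩ := S.hl i hL
  have hlp := S.lp i
  have hab : (l i).a = (l i).b := by
    rcases (S.ab i).lt_or_eq with h | h
    · exact (S.K1 hL h (by linarith) (S.pC j) h1 h3).elim
    · exact h
  set c := (l i).p.1 with hc
  have key : ∀ z ∈ C, z.1 = c → (l i).p.2 ≤ z.2 := by
    intro z hz hzc
    by_contra hcon
    push Not at hcon
    exact LMs S.cc hlm (S.pC j) hz h3 hzc.le (by nlinarith) hcon.ne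
  have hsx : c < (l i).s.1 := by
    by_contra hcon
    push Not at hcon
    rcases hs.lt_or_eq with h | h
    · exact LMs S.cc hlm (S.pC j) (S.IC _ (S.sI i)) h3 hcon (by nlinarith) h.ne
    · have := hlm _ (S.IC _ (S.sI i)) h
      have : (l i).s = (l i).p := by ext; linarith; exact h
      exact S.pI i (this ▸ S.sI i)
  -- points on the leader of `j` to the left of `c` are below `hi`
  have below : ∀ z, SSeg (l j).s (l j).p z → z.1 ≤ c → z.2 < (l i).hi := by
    intro z hz hzc
    by_contra hcon
    push Not at hcon
    obtain ⟨y, hy, hyh⟩ := sseg_y (a := z) (b := (l j).p) (c := (l i).hi) (by nlinarith)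
    refine S.adjb i j hadj y ⟨by rw [hyh, hb], Or.inl ⟨hL, ?_⟩⟩ (Or.inr (sseg_sub hz (sseg_r _ _) hy))
    have := sseg_x_le hy hzc h3.le
    linarith
  by_cases hsj : (l j).s.1 ≤ c
  · have hb1 := below _ (sseg_l _ _) hsj
    obtain ⟨z, hz, hzc⟩ := sseg_x (a := (l i).s) (b := (l j).s) (c := c) (by nlinarith)
    have hzC := S.conv _ (S.IC _ (S.sI i)) _ (S.IC _ (S.sI j)) _ hz
    have := key z hzC hzc
    have h5 := sseg_y_lt hz (m := (l i).hi) (by linarith) hb1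
    exact S.hull i i j z hz ⟨by linarith, by linarith, by linarith, h5.le⟩
  · push Not at hsj
    obtain ⟨z, hz, hzc⟩ := sseg_x (a := (l j).s) (b := (l j).p) (c := c) (by nlinarith)
    have hzC := S.conv _ (S.IC _ (S.sI j)) _ (S.pC j) _ hz
    have := key z hzC hzc
    have h5 := below z hz hzc.le
    exact S.adjd i j hadj z (Or.inl ⟨by linarith, by linarith, by linarith, h5.le⟩) (Or.inr hz)

lemma cross_oseg {u v p : Pt} (h : OSeg u v p) : cross2 u v p = 0 := by
  obtain ⟨t, _, _, rfl⟩ := h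
  simp [cross2]; ring

lemma G1 (hC : CConv C) {p u v : Pt} (hp : ∀ x ∈ C, x.2 = p.2 → x.1 ≤ p.1)
    (hu : u ∈ C) (hv : v ∈ C) (h : OSeg u v p) (huv : u.2 < v.2) : ∀ x ∈ C, 0 ≤ cross2 u v x := by
  intro x hx
  obtain ⟨t, t0, t1, rfl⟩ := h
  simp only at hp
  by_contra hcon
  push Not at hcon
  by_cases hx2 : x.2 ≤ u.2 + t * (v.2 - u.2)
  · have := RM hC (p := (u.1 + t * (v.1 - u.1), u.2 + t * (v.2 - u.2))) hp hx hv hx2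
      (by simp only; nlinarith) (by nlinarith)
    unfold cross2 at this hcon
    simp only at this
    have e : (v.1 - x.1) * (u.2 + t * (v.2 - u.2) - x.2) - (v.2 - x.2) * (u.1 + t * (v.1 - u.1) - x.1) =
      -(1 - t) * ((v.1 - u.1) * (x.2 - u.2) - (v.2 - u.2) * (x.1 - u.1)) := by ring
    rw [e] at this
    nlinarith
  · push Not at hx2
    have := RM hC (p := (u.1 + t * (v.1 - u.1), u.2 + t * (v.2 - u.2))) hp hu hx 
      (by simp only; nlinarith) hx2.le (by nlinarith)
    unfold cross2 at this hcon
    simp only at this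
    have e : (x.1 - u.1) * (u.2 + t * (v.2 - u.2) - u.2) - (x.2 - u.2) * (u.1 + t * (v.1 - u.1) - u.1) =
      - t * ((v.1 - u.1) * (x.2 - u.2) - (v.2 - u.2) * (x.1 - u.1)) := by ring
    rw [e] at this
    nlinarith

lemma G1L (hC : CConv C) {p u v : Pt} (hp : ∀ x ∈ C, x.2 = p.2 → p.1 ≤ x.1)
    (hu : u ∈ C) (hv : v ∈ C) (h : OSeg u v p) (huv : u.2 < v.2) : ∀ x ∈ C, cross2 u v x ≤ 0 := by
  intro x hx
  have := G1 (C := {u | mx u ∈ C}) (p := mx p) (u := mx u) (v := mx v)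
    (fun a ha b hb z hz => hC _ ha _ hb _ (sseg_mx (by simpa using hz)))
    (fun x hx h => by have := hp _ hx (by simpa using h); simp at this ⊢; linarith)
    (by simpa using hu) (by simpa using hv) (oseg_mx (by simpa using h)) huv (mx x) (by simpa using hx)
  rw [cross2_mx] at this
  linarith

/-- `C` is not contained in a nonhorizontal line. -/
lemma Sys.noline (S : Sys C I l adj) (i : ι) {u v : Pt} (huv : u.2 < v.2)
    (h : ∀ x ∈ C, cross2 u v x = 0) : False := by
  obtain ⟨x, hx, h1, h2⟩ := S.Il _ (S.sI i)
  have e1 := h _ hx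
  have e2 := h _ (S.IC _ (S.sI i))
  unfold cross2 at e1 e2
  rw [h1] at e1
  nlinarith

lemma line_param {u v x : Pt} (huv : u.2 < v.2) (h : cross2 u v x = 0) :
    ∃ t : ℝ, x = (u.1 + t * (v.1 - u.1), u.2 + t * (v.2 - u.2)) := by
  have hpos : v.2 - u.2 ≠ 0 := by intro h; linarith
  have e : (x.2 - u.2) / (v.2 - u.2) * (v.2 - u.2) = x.2 - u.2 := div_mul_cancel₀ _ hpos
  refine ⟨(x.2 - u.2) / (v.2 - u.2), ?_⟩
  ext
  · simp only
    unfold cross2 at h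
    field_simp
    linarith
  · simp only [e]; ring

/-- collinear point with a leftmost lower endpoint and beyond it -/
lemma G2 (hC : CConv C) {u v x : Pt} (huv : u.2 < v.2)
    (hu : u ∈ C) (hv : v ∈ C) (hx : x ∈ C) (hc : cross2 u v x = 0) (hlt : x.2 < u.2)
    (hp : ∀ y ∈ C, y.2 = u.2 → u.1 ≤ y.1) : ∀ y ∈ C, cross2 u v y ≤ 0 := by
  intro y hy
  obtain ⟨t, rfl⟩ := line_param huv hc
  simp only at hlt
  have ht : t < 0 := by by_contra h; push Not at h; nlinarith
  have h1t : 0 < 1 - t := by linarith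
  have := G1L hC hp hx hv ?_ (by simp only; linarith) y hy
  · unfold cross2 at this ⊢
    simp only at this
    have e : (v.1 - (u.1 + t * (v.1 - u.1))) * (y.2 - (u.2 + t * (v.2 - u.2))) -
      (v.2 - (u.2 + t * (v.2 - u.2))) * (y.1 - (u.1 + t * (v.1 - u.1))) =
      (1 - t) * ((v.1 - u.1) * (y.2 - u.2) - (v.2 - u.2) * (y.1 - u.1)) := by ring
    rw [e] at this
    by_contra hcon; push Not at hcon
    nlinarith
  · refine ⟨-t / (1 - t), by apply div_pos <;> linarith, by rw [div_lt_one h1t]; linarith, ?_⟩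
    ext <;> simp only <;> field_simp <;> ring

lemma G2' (hC : CConv C) {u v x : Pt} (huv : u.2 < v.2)
    (hu : u ∈ C) (hv : v ∈ C) (hx : x ∈ C) (hc : cross2 u v x = 0) (hlt : v.2 < x.2)
    (hp : ∀ y ∈ C, y.2 = v.2 → v.1 ≤ y.1) : ∀ y ∈ C, cross2 u v y ≤ 0 := by
  intro y hy
  have e : ∀ z, cross2 (my v) (my u) (my z) = cross2 u v z := by
    intro z; simp [cross2]; ring
  have := G2 (C := {u | my u ∈ C}) (u := my v) (v := my u) (x := my x)
    (fun a ha b hb z hz => hC _ ha _ hb _ (sseg_my (by simpa using hz)))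
    (by simpa using huv) (by simpa using hv) (by simpa using hu) (by simpa using hx)
    (by rw [e]; exact hc) (by simpa using hlt)
    (fun y hy h => by have := hp _ hy (by simp at h ⊢; linarith); simpa using this) (my y) (by simpa using hy)
  rw [e] at this; exact this

lemma Sys.pne (S : Sys C I l adj) {i j : ι} (h : i ≠ j) : (l i).p ≠ (l j).p := fun he =>
  S.lead i j h _ (sseg_r _ _) (by rw [he]; exact sseg_r _ _)

lemma Sys.btwL (S : Sys C I l adj) {i j : ι} (hij : i ≠ j) (hn : ¬ adj i j) {u v : Pt}
    (huv : (u = (l i).p ∧ v = (l j).p) ∨ (u = (l j).p ∧ v = (l i).p)) (hlt : u.2 < v.2)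
    (h1 : ∀ k, k ≠ i → k ≠ j → 0 < cross2 u v (l k).p → u.2 < (l k).p.2 ∧ (l k).p.2 < v.2)
    (h2 : ∀ k, k ≠ i → k ≠ j → cross2 u v (l k).p = 0 → ¬ OSeg u v (l k).p →
      (∀ x ∈ C, 0 ≤ cross2 u v x) → False) :
    ∃ b, adj i b ∧ (l b).left = true ∧ u.2 < (l b).p.2 ∧ (l b).p.2 < v.2 := by
  have hu : u ∈ C := by rcases huv with h | h <;> rw [h.1] <;> exact S.pC _
  have hv : v ∈ C := by rcases huv with h | h <;> rw [h.2] <;> exact S.pC _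
  have strict : ∀ b, adj i b → 0 < cross2 u v (l b).p →
      ∃ b, adj i b ∧ (l b).left = true ∧ u.2 < (l b).p.2 ∧ (l b).p.2 < v.2 := by
    intro b hb hc
    have hbj : b ≠ j := fun h => hn (h ▸ hb)
    have hbi : b ≠ i := fun h => S.adjn _ _ hb h.symm
    obtain ⟨q1, q2⟩ := h1 b hbi hbj hc
    refine ⟨b, hb, ?_, q1, q2⟩
    by_contra hL
    have := RM S.cc (S.hr b (by simpa using hL)).2 hu hv q1.le q2.le hlt
    linarith
  have main : ∀ b b', adj i b → adj i b' → OSeg u v (l b).p → ¬ OSeg u v (l b').p →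
      ∃ b, adj i b ∧ (l b).left = true ∧ u.2 < (l b).p.2 ∧ (l b).p.2 < v.2 := by
    intro b b' hb hb' ho ho'
    by_cases hL : (l b).left = true
    · refine ⟨b, hb, hL, ?_⟩
      obtain ⟨t, t0, t1, e⟩ := ho
      rw [e]; constructor <;> simp only <;> nlinarith
    · have hg := G1 S.cc (S.hr b (by simpa using hL)).2 hu hv ho hlt
      rcases (hg _ (S.pC b')).lt_or_eq with h | h
      · exact strict b' hb' h
      · exact (h2 b' (fun h => S.adjn _ _ hb' h.symm) (fun h => hn (h ▸ hb')) h.symm ho' hg).elim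
  obtain ⟨b, b', hb, hb', h3⟩ := S.F i j hij hn
  rcases huv with ⟨rfl, rfl⟩ | ⟨rfl, rfl⟩
  · rcases h3 with ⟨h3, h4⟩ | ⟨h3, h4⟩
    · exact strict b hb h3
    · exact main b b' hb hb' h3 h4
  · rcases h3 with ⟨h3, h4⟩ | ⟨h3, h4⟩
    · refine strict b' hb' ?_
      unfold cross2 at h4 ⊢; linarith
    · exact main b b' hb hb' (oseg_symm h3) (fun h => h4 (oseg_symm h))

lemma not_oseg_beyond {u v x : Pt} (huv : u.2 < v.2) (hc : cross2 u v x = 0) (ho : ¬ OSeg u v x)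
    (h1 : x ≠ u) (h2 : x ≠ v) : x.2 < u.2 ∨ v.2 < x.2 := by
  obtain ⟨t, rfl⟩ := line_param huv hc
  rcases lt_trichotomy t 0 with h | h | h
  · left; simp only; nlinarith
  · exact (h1 (by subst h; ext <;> simp)).elim
  · rcases lt_trichotomy t 1 with h' | h' | h'
    · exact (ho ⟨t, h, h', rfl⟩).elim
    · exact (h2 (by subst h'; ext <;> simp)).elim
    · right; simp only; nlinarith

lemma Sys.btwLL (S : Sys C I l adj) {i j : ι} (hij : i ≠ j) (hn : ¬ adj i j)
    (hi : (l i).left = true) (hj : (l j).left = true) (hlt : (l i).p.2 < (l j).p.2) :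
    ∃ b, adj i b ∧ (l b).left = true ∧ (l i).p.2 < (l b).p.2 ∧ (l b).p.2 < (l j).p.2 := by
  refine S.btwL hij hn (Or.inl ⟨rfl, rfl⟩) hlt ?_ ?_
  · intro k hki hkj hc
    constructor
    · by_contra hcon; push Not at hcon
      have := LM S.cc (S.hl i hi).2 (S.pC k) (S.pC j) hcon hlt.le (by linarith)
      unfold cross2 at this hc; linarith
    · by_contra hcon; push Not at hcon
      have := LM S.cc (S.hl j hj).2 (S.pC i) (S.pC k) hlt.le hcon (by linarith)
      unfold cross2 at this hc; linarith
  · intro k hki hkj hc ho hC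
    rcases not_oseg_beyond hlt hc ho (S.pne hki) (S.pne hkj) with h | h
    · have := G2 S.cc hlt (S.pC i) (S.pC j) (S.pC k) hc h (S.hl i hi).2
      exact S.noline i hlt (fun x hx => le_antisymm (this x hx) (hC x hx))
    · have := G2' S.cc hlt (S.pC i) (S.pC j) (S.pC k) hc h (S.hl j hj).2
      exact S.noline i hlt (fun x hx => le_antisymm (this x hx) (hC x hx))

def LowL (C : Set Pt) (b : BLab) : Prop := ∃ w ∈ C, (∀ u ∈ C, w.1 ≤ u.1) ∧ b.p.2 ≤ w.2

/-- on the lower left chain, higher ports are further left -/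
lemma Sys.lowx (S : Sys C I l adj) {i j : ι}
    (hj : (l j).left = true) (hJ : LowL C (l j)) (hlt : (l i).p.2 < (l j).p.2) :
    (l j).p.1 ≤ (l i).p.1 := by
  obtain ⟨w, hw, hmin, h⟩ := hJ
  by_contra hcon; push Not at hcon
  rcases h.lt_or_eq with h | h
  · exact LMs S.cc (S.hl j hj).2 (S.pC i) hw hcon (by have := hmin _ (S.pC i); linarith)
      (by nlinarith) h.ne'
  · have := (S.hl j hj).2 w hw h.symm
    have := hmin _ (S.pC i)
    linarith

lemma Sys.AL (S : Sys C I l adj) {i j : ι} (hi : (l i).left = true)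
    (hj : (l j).left = true) (hJ : LowL C (l j)) (hlt : (l i).p.2 < (l j).p.2) (hadj : adj i j) :
    (l i).lo < (l j).lo ∧ ((l i).hi < (l j).lo ∨ (l j).b < (l i).a) := by
  have hx := S.lowx hj hJ hlt
  have bi := (S.hl i hi).1
  have bj := (S.hl j hj).1
  have := S.lp i
  have := S.ph i
  have := S.lp j
  have := S.ph j
  have := S.ab i
  have := S.ab j
  have hlo : (l i).lo < (l j).lo := by
    by_contra hcon; push Not at hcon
    have h1 : (l j).p.1 < (l i).a := by
      by_contra hc; push Not at hc
      refine S.adjd i j hadj ((l j).p.1, (l i).lo) (Or.inl ⟨?_, ?_, ?_, ?_⟩) (Or.inl ⟨?_, ?_, ?_, ?_⟩) <;>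
        simp only <;> linarith
    have hit : ∀ h, (l i).bl = h → (l i).lo ≤ h → h ≤ (l j).hi → False := by
      intro h e1 e2 e3
      refine S.adjb i j hadj ((l j).p.1, h) ⟨e1.symm, Or.inl ⟨hi, h1.le⟩⟩ (Or.inl ⟨?_, ?_, ?_, ?_⟩) <;>
        simp only <;> linarith
    rcases S.hbl i with ⟨e, hs⟩ | ⟨e, hs⟩
    · by_cases hh : (l i).hi ≤ (l j).hi
      · exact hit _ e (by linarith) hh
      · push Not at hh
        exact S.ALC hi hadj hlt (by linarith) (by linarith) e hs
    · exact hit _ e le_rfl (by linarith)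
  refine ⟨hlo, ?_⟩
  by_contra hcon; push Not at hcon
  obtain ⟨c1, c2⟩ := hcon
  refine S.adjd i j hadj ((l j).b, (l j).lo) (Or.inl ⟨?_, ?_, ?_, ?_⟩) (Or.inl ⟨?_, ?_, ?_, ?_⟩) <;>
        simp only <;> linarith

lemma Sys.chain [Finite ι] (S : Sys C I l adj) {j : ι}
    (hj : (l j).left = true) (hJ : LowL C (l j)) :
    ∀ (n : ℕ) (i : ι), (l i).left = true → (l i).p.2 < (l j).p.2 →
      {k | (l i).p.2 < (l k).p.2}.ncard ≤ n →
    (l i).lo < (l j).lo ∧ ((l i).hi < (l j).lo ∨ (l j).b < (l i).a) := by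
  intro n
  induction n with
  | zero =>
    intro i hi hlt hc
    have h0 : {k | (l i).p.2 < (l k).p.2}.ncard = 0 := by omega
    rw [Set.ncard_eq_zero (Set.toFinite _)] at h0
    have : j ∈ {k | (l i).p.2 < (l k).p.2} := hlt
    rw [h0] at this; exact this.elim
  | succ n ih =>
    intro i hi hlt hc
    by_cases hadj : adj i j
    · exact S.AL hi hj hJ hlt hadj
    · have hij : i ≠ j := fun h => by rw [h] at hlt; exact lt_irrefl _ hlt
      obtain ⟨e, hae, he, e1, e2⟩ := S.btwLL hij hadj hi hj hlt
      have hlow : LowL C (l e) := by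
        obtain ⟨w, hw, hm, h⟩ := hJ
        exact ⟨w, hw, hm, by linarith⟩
      have A1 := S.AL hi he hlow e1 hae
      have A2 := ih e he e2 (by
        have : {k | (l e).p.2 < (l k).p.2}.ncard < {k | (l i).p.2 < (l k).p.2}.ncard := by
          apply Set.ncard_lt_ncard _ (Set.toFinite _)
          refine ⟨fun k hk => lt_trans e1 hk, fun h => ?_⟩
          have this : (l e).p.2 < (l e).p.2 := h e1
          exact lt_irrefl _ this
        omega)
      have hx := S.lowx hj hJ e2
      have b1 := (S.hl e he).1
      have b2 := (S.hl j hj).1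
      refine ⟨A1.1.trans A2.1, ?_⟩
      rcases A1.2 with h | h
      · left; linarith [A2.1]
      · right; linarith

lemma Sys.chainL [Finite ι] (S : Sys C I l adj) {i j : ι} (hi : (l i).left = true)
    (hj : (l j).left = true) (hJ : LowL C (l j)) (hlt : (l i).p.2 < (l j).p.2) :
    (l i).lo < (l j).lo ∧ ((l i).hi < (l j).lo ∨ (l j).b < (l i).a) :=
  S.chain hj hJ _ i hi hlt le_rfl

end StaircaseCore2

section StaircaseCore3

variable {ι : Type} {C I : Set Pt} {l : ι → BLab} {adj : ι → ι → Prop}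

lemma Sys.T_end [Finite ι] (S : Sys C I l adj) {A r : ι} (hz : (l A).a = (l A).b)
    (hpx : (l A).p.1 = (l A).a) (hrL : (l r).left = true) (hne : A ≠ r) (hn : ¬ adj A r)
    {y0 : ℝ} (hbox : (l r).inBox ((l A).p.1, y0)) (h1 : (l A).lo ≤ y0)
    (h2 : y0 < (l A).p.2) (hall : ∀ k, k ≠ A → (l A).p.1 < (l k).p.1)
    (h3 : (l r).p.2 < (l A).p.2) : False := by
  obtain ⟨x1, x2, x3, x4⟩ := hbox
  simp only at x1 x2 x3 x4
  obtain ⟨rb, rlm⟩ := S.hl r hrL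
  have hcr := hall r hne.symm
  have hih : (l r).hi ≤ (l r).p.2 := by
    by_contra hcon; push Not at hcon
    exact S.K1 hrL (by linarith) hcon (S.pC A) h3 hcr
  obtain ⟨B, hB, hBL, q1, q2⟩ := S.btwL hne hn (Or.inr ⟨rfl, rfl⟩) h3 (by
    intro k hkA hkr hc
    have hck := hall k hkA
    constructor
    · by_contra hcon; push Not at hcon
      have := LM S.cc rlm (S.pC k) (S.pC A) hcon h3.le (by linarith)
      unfold cross2 at this hc; linarith
    · by_contra hcon; push Not at hcon
      unfold cross2 at hc
      nlinarith) (by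
    intro k hkA hkr hc ho hC
    have hck := hall k hkA
    rcases not_oseg_beyond h3 hc ho (S.pne hkr) (S.pne hkA) with h | h
    · have := G2 S.cc h3 (S.pC r) (S.pC A) (S.pC k) hc h rlm
      exact S.noline A h3 (fun x hx => le_antisymm (this x hx) (hC x hx))
    · unfold cross2 at hc
      nlinarith)
  have hBA : B ≠ A := fun h => S.adjn _ _ hB h.symm
  have hcB := hall B hBA
  obtain ⟨Bb, Blm⟩ := S.hl B hBL
  have hlow : LowL C (l B) := by
    obtain ⟨w, hw, hm⟩ := S.xmin
    refine ⟨w, hw, hm, ?_⟩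
    by_contra hcon; push Not at hcon
    have := LM S.cc Blm hw (S.pC A) hcon.le q2.le (by linarith)
    have hm := hm _ (S.pC A)
    unfold cross2 at this
    nlinarith
  obtain ⟨-, hch⟩ := S.chainL hrL hBL hlow q1
  have hch : (l r).hi < (l B).lo := by
    rcases hch with h | h
    · exact h
    · linarith
  have blp := S.lp B
  have bph := S.ph B
  have alp := S.lp A
  have aph := S.ph A
  by_cases haB : (l B).a ≤ (l A).p.1
  · refine S.adjd A B hB ((l A).p.1, (l B).lo) (Or.inl ⟨?_, ?_, ?_, ?_⟩) (Or.inl ⟨?_, ?_, ?_, ?_⟩) <;>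
        simp only <;> linarith
  · push Not at haB
    have hit : ∀ h, (l B).bl = h → (l A).lo ≤ h → h ≤ (l A).hi → False := by
      intro h e1 e2 e3
      refine S.adjb B A (S.adjs _ _ hB) ((l A).p.1, h) ⟨e1.symm, Or.inl ⟨hBL, haB.le⟩⟩
        (Or.inl ⟨?_, ?_, ?_, ?_⟩) <;> simp only <;> linarith
    rcases S.hbl B with ⟨e, hs⟩ | ⟨e, hs⟩
    · by_cases hh : (l B).hi ≤ (l A).p.2
      · exact hit _ e (by linarith) (by linarith)
      · push Not at hh
        exact S.ALC hBL (S.adjs _ _ hB) q2 hh hcB e hs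
    · exact hit _ e (by linarith) (by linarith)

end StaircaseCore3

section StaircaseCore3b

variable {ι : Type} {C I : Set Pt} {l : ι → BLab} {adj : ι → ι → Prop}

lemma cross_zero {k : ℝ} {a b u v : Pt} (hu : k * cross2 a b u ≤ 0) (hv : 0 < k * cross2 a b v) :
    ∃ τ : ℝ, 0 ≤ τ ∧ τ < 1 ∧ cross2 a b (u.1 + τ * (v.1 - u.1), u.2 + τ * (v.2 - u.2)) = 0 := by
  have hpos : 0 < k * cross2 a b v - k * cross2 a b u := by linarith
  have hk : k ≠ 0 := by rintro rfl; simp at hv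
  have hne : cross2 a b v - cross2 a b u ≠ 0 := by
    intro h
    have : k * (cross2 a b v - cross2 a b u) = 0 := by rw [h]; ring
    linarith
  have e : (-(k * cross2 a b u) / (k * cross2 a b v - k * cross2 a b u)) *
    (k * cross2 a b v - k * cross2 a b u) = -(k * cross2 a b u) := div_mul_cancel₀ _ hpos.ne'
  refine ⟨-(k * cross2 a b u) / (k * cross2 a b v - k * cross2 a b u),
    div_nonneg (by linarith) hpos.le, by rw [div_lt_one hpos]; linarith, ?_⟩
  set τ := -(k * cross2 a b u) / (k * cross2 a b v - k * cross2 a b u)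
  have : k * cross2 a b (u.1 + τ * (v.1 - u.1), u.2 + τ * (v.2 - u.2)) = 0 := by
    have : k * cross2 a b (u.1 + τ * (v.1 - u.1), u.2 + τ * (v.2 - u.2)) =
      k * cross2 a b u + τ * (k * cross2 a b v - k * cross2 a b u) := by
      unfold cross2; simp only; ring
    rw [this, e]; ring
  exact (mul_eq_zero.1 this).resolve_left hk

lemma line_param_x {u v x : Pt} (huv : v.1 - u.1 ≠ 0) (h : cross2 u v x = 0) :
    ∃ t : ℝ, x = (u.1 + t * (v.1 - u.1), u.2 + t * (v.2 - u.2)) := by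
  have e : (x.1 - u.1) / (v.1 - u.1) * (v.1 - u.1) = x.1 - u.1 := div_mul_cancel₀ _ huv
  refine ⟨(x.1 - u.1) / (v.1 - u.1), ?_⟩
  ext
  · simp only [e]; ring
  · simp only
    unfold cross2 at h
    field_simp
    linarith

lemma Sys.mu_le (S : Sys C I l adj) {r : ι} {μ : ℝ} (hμ : 1 < μ)
    (hy : ((l r).s.1 + μ * ((l r).p.1 - (l r).s.1), (l r).s.2 + μ * ((l r).p.2 - (l r).s.2)) ∈ C) :
    False := by
  have h0 : μ ≠ 0 := by linarith
  refine S.pI r (S.Iseg _ (S.sI r) _ hy _ ⟨1 / μ, by positivity, by rw [div_lt_one (by linarith)]; exact hμ, ?_⟩)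
  ext <;> simp only <;> field_simp <;> ring

lemma Sys.upA (S : Sys C I l adj) {A : ι} (hA : (l A).left = true)
    {w : Pt} (hw : w ∈ C) (hw1 : w.1 < (l A).p.1) (hw2 : w.2 < (l A).p.2) :
    ∀ u ∈ C, u.1 ≤ (l A).p.1 → u.2 ≤ (l A).p.2 := by
  intro u hu h
  by_contra hcon; push Not at hcon
  exact LMs S.cc (S.hl A hA).2 hw hu hw1 h (by nlinarith) hcon.ne'

lemma sign_tr {x y s : ℝ} (hs : s ≠ 0) (hx : x * s ≤ 0) (hy : 0 ≤ y * s) : x * y ≤ 0 := by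
  have h : (x * y) * (s * s) ≤ 0 := by nlinarith
  have hp : 0 < s * s := mul_self_pos.2 hs
  by_contra hc; push Not at hc
  nlinarith

set_option maxHeartbeats 1600000 in
lemma Sys.step1 (S : Sys C I l adj) {A r : ι} (hA : (l A).left = true) (hz : (l A).a = (l A).b)
    {w : Pt} (hw : w ∈ C) (hw1 : w.1 < (l A).p.1) (hw2 : w.2 < (l A).p.2)
    (hne : A ≠ r) {h : Pt} (hseg : SSeg (l r).s (l r).p h) (hbox : (l A).inBox h) : False := by
  have up := S.upA hA hw hw1 hw2
  have hn : ¬ adj A r := fun ha => S.adjd A r ha h (Or.inl hbox) (Or.inr hseg)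
  obtain ⟨pb, -⟩ := S.hl A hA
  have Alp := S.lp A
  have Aph := S.ph A
  have inA : ∀ z ∈ C, z.1 = (l A).p.1 → (l A).lo ≤ z.2 → (l A).inBox z := fun z hzC hz1 hz2 =>
    ⟨by linarith, by linarith, hz2, by have := up z hzC hz1.le; linarith⟩
  have hhC : h ∈ C := S.conv _ (S.IC _ (S.sI r)) _ (S.pC r) _ hseg
  obtain ⟨b1, b2, b3, b4⟩ := hbox
  have hh1 : h.1 = (l A).p.1 := by linarith
  have hh2 : h.2 < (l A).p.2 := by
    rcases (up h hhC hh1.le).lt_or_eq with h' | h'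
    · exact h'
    · have : h = (l A).p := by ext; exact hh1; exact h'
      exact (S.lead A r hne h (by rw [this]; exact sseg_r _ _) hseg).elim
  obtain ⟨t, t0, t1, ht⟩ := id hseg
  have hsr := S.IC _ (S.sI r)
  set s := (l r).s with hs
  set q := (l r).p with hq
  set p := (l A).p with hp
  have ht1 : h.1 = s.1 + t * (q.1 - s.1) := by rw [ht]
  have ht2 : h.2 = s.2 + t * (q.2 - s.2) := by rw [ht]
  have hsc : s.1 ≠ p.1 := by
    intro hsc
    have hs2 : s.2 < (l A).lo := by
      by_contra hc; push Not at hc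
      exact S.hull A r r s (sseg_l _ _) (inA s hsr hsc hc)
    have tpos : 0 < t := by
      rcases t0.lt_or_eq with h' | h'
      · exact h'
      · rw [← h'] at ht2; linarith
    have hq1 : q.1 = p.1 := by
      have : t * (q.1 - s.1) = 0 := by linarith
      have := (mul_eq_zero.1 this).resolve_left tpos.ne'
      linarith
    have hq2 : q.2 < p.2 := by
      rcases (up q (S.pC r) hq1.le).lt_or_eq with h' | h'
      · exact h'
      · exact (S.pne hne (by rw [← hp, ← hq]; ext; exact hq1.symm; exact h'.symm)).elim
    have hqs : s.2 < q.2 := by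
      by_contra hc; push Not at hc; nlinarith
    refine S.pI r (S.Iseg s (S.sI r) p (S.pC A) _ ⟨(q.2 - s.2) / (p.2 - s.2),
      div_pos (by linarith) (by linarith), by rw [div_lt_one (by linarith)]; linarith, ?_⟩)
    have e : (q.2 - s.2) / (p.2 - s.2) * (p.2 - s.2) = q.2 - s.2 :=
      div_mul_cancel₀ _ (by intro h; linarith)
    ext
    · simp only [hsc]; rw [← hq, hq1]; ring
    · simp only [e]; rw [← hq]; ring
  set d := q.1 - s.1 with hd
  have hcs : p.1 = s.1 + t * d := by linarith
  have d0 : d ≠ 0 := by intro h; rw [h] at hcs; apply hsc; linarith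
  have tpos : 0 < t := by
    rcases t0.lt_or_eq with h' | h'
    · exact h'
    · rw [← h'] at hcs; exact (hsc (by linarith)).elim
  have d2 : 0 < d * d := mul_self_pos.2 d0
  have sc0 : s.1 - p.1 ≠ 0 := fun h => hsc (by linarith)
  -- values of f on the line x = c
  have fx : ∀ z : Pt, z.1 = p.1 → cross2 s q z = d * (z.2 - h.2) := by
    intro z hz; unfold cross2; rw [hz, hcs, ht2]; ring
  have fpp : 0 < d * cross2 s q p := by
    rw [fx p rfl]; nlinarith
  have gs : d * cross2 p q s < 0 := by
    have : cross2 p q s = - cross2 s q p := by unfold cross2; ring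
    rw [this]; linarith
  have Dq : (q.1 - p.1) * (s.1 - p.1) ≤ 0 := by
    have : (q.1 - p.1) * (s.1 - p.1) = - (t * (1 - t)) * (d * d) := by rw [hcs, hd]; ring
    rw [this]; nlinarith [mul_nonneg t0 (sub_nonneg.2 t1)]
  obtain ⟨B, hB, hg⟩ : ∃ B, adj A B ∧ (0 < d * cross2 p q (l B).p ∨ OSeg p q (l B).p) := by
    obtain ⟨b, b', hb, hb', h3⟩ := S.F A r hne hn
    rcases h3 with ⟨h3, h4⟩ | ⟨h3, h4⟩
    · rcases lt_or_gt_of_ne d0 with h' | h'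
      · exact ⟨b', hb', Or.inl (mul_pos_of_neg_of_neg h' h4)⟩
      · exact ⟨b, hb, Or.inl (mul_pos h' h3)⟩
    · exact ⟨b, hb, Or.inr h3⟩
  have hBr : B ≠ r := fun h => hn (h ▸ hB)
  have hBA : A ≠ B := S.adjn _ _ hB
  have hpB := S.pC B
  have hsB := S.IC _ (S.sI B)
  have st1 : 0 < d * cross2 s q (l B).p := by
    rcases hg with hg | hg
    · by_contra hcon; push Not at hcon
      obtain ⟨τ, τ0, τ1, hc0⟩ := cross_zero hcon fpp
      have hyC : ((l B).p.1 + τ * (p.1 - (l B).p.1), (l B).p.2 + τ * (p.2 - (l B).p.2)) ∈ C :=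
        S.conv _ hpB _ (S.pC A) _ ⟨τ, τ0, τ1.le, rfl⟩
      have hgy : 0 < d * cross2 p q ((l B).p.1 + τ * (p.1 - (l B).p.1), (l B).p.2 + τ * (p.2 - (l B).p.2)) := by
        have : d * cross2 p q ((l B).p.1 + τ * (p.1 - (l B).p.1), (l B).p.2 + τ * (p.2 - (l B).p.2)) =
          (1 - τ) * (d * cross2 p q (l B).p) := by unfold cross2; simp only; ring
        rw [this]; exact mul_pos (by linarith) hg
      obtain ⟨μ, hμ⟩ := line_param_x d0 hc0
      rw [hμ] at hyC hgy
      refine S.mu_le (r := r) (μ := μ) ?_ hyC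
      have : d * cross2 p q (s.1 + μ * (q.1 - s.1), s.2 + μ * (q.2 - s.2)) =
        (1 - μ) * (d * cross2 p q s) := by unfold cross2; simp only; ring
      rw [this] at hgy
      by_contra hc; push Not at hc; nlinarith
    · obtain ⟨τ, τ0, τ1, e⟩ := hg
      have : d * cross2 s q (l B).p = (1 - τ) * (d * cross2 s q p) := by
        rw [e]; unfold cross2; simp only; ring
      rw [this]; exact mul_pos (by linarith) fpp
  have st2 : ∀ y, SSeg (l B).s (l B).p y → cross2 s q y = 0 → 0 < (y.1 - p.1) * (s.1 - p.1) := by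
    intro y hy h0
    obtain ⟨μ, hμ⟩ := line_param_x d0 h0
    have hyC := S.conv _ hsB _ hpB _ hy
    have m1 : μ ≤ 1 := by
      by_contra hc; push Not at hc
      rw [hμ] at hyC
      exact S.mu_le (r := r) hc hyC
    have m0 : μ < 0 := by
      by_contra hc; push Not at hc
      exact S.lead B r hBr y hy ⟨μ, hc, m1, hμ⟩
    have : (y.1 - p.1) * (s.1 - p.1) = t * (t - μ) * (d * d) := by
      rw [hμ, hcs]; simp only; rw [← hd]; ring
    rw [this]
    exact mul_pos (mul_pos tpos (by linarith)) d2
  have st3 : ((l B).p.1 - p.1) * (s.1 - p.1) ≤ 0 := by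
    rcases hg with hg | hg
    · by_contra hcon; push Not at hcon
      obtain ⟨z, ⟨τ, τ0, τ1, e⟩, hz1⟩ := sseg_x (a := q) (b := (l B).p) (c := p.1)
        (sign_tr sc0 Dq hcon.le)
      have hzC : z ∈ C := S.conv _ (S.pC r) _ hpB _ ⟨τ, τ0, τ1, e⟩
      have hz2 := up z hzC hz1.le
      have g1 : d * cross2 p q z = τ * (d * cross2 p q (l B).p) := by
        rw [e]; unfold cross2; simp only; ring
      have g2 : d * cross2 p q z = ((1 - t) * (d * d)) * (z.2 - p.2) := by
        unfold cross2; rw [hz1]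
        have : q.1 - p.1 = (1 - t) * d := by rw [hcs, hd]; ring
        rw [this]; ring
      have g3 : τ * (d * cross2 p q (l B).p) ≤ 0 := by
        rw [← g1, g2]
        exact mul_nonpos_of_nonneg_of_nonpos (mul_nonneg (by linarith) d2.le) (by linarith)
      have τz : τ = 0 := by
        by_contra hc
        have : 0 < τ := lt_of_le_of_ne τ0 (Ne.symm hc)
        nlinarith
      have hq1 : q.1 = p.1 := by
        rw [← hz1, e, τz]; simp
      have tt : t = 1 := by
        have : (1 - t) * d = 0 := by rw [hcs, ] at hq1; linarith
        have := (mul_eq_zero.1 this).resolve_right d0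
        linarith
      have hhq : h.2 = q.2 := by rw [ht2, tt]; ring
      have e1 : d * cross2 p q (l B).p = -(p.2 - h.2) * (((l B).p.1 - p.1) * (s.1 - p.1)) := by
        unfold cross2; rw [hhq, hq1]
        have : s.1 - p.1 = - d := by rw [hcs, tt]; ring
        rw [this]; ring
      rw [e1] at hg
      have := mul_pos (show 0 < p.2 - h.2 by linarith) hcon
      linarith
    · obtain ⟨τ, τ0, τ1, e⟩ := hg
      have : ((l B).p.1 - p.1) * (s.1 - p.1) = τ * ((q.1 - p.1) * (s.1 - p.1)) := by
        rw [e]; simp only; ring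
      rw [this]; nlinarith
  have st4 : ∀ y, SSeg (l B).s (l B).p y → (y.1 - p.1) * (s.1 - p.1) ≤ 0 →
      0 < d * cross2 s q y := by
    intro y hy hD
    by_contra hcon; push Not at hcon
    obtain ⟨τ, τ0, τ1, hc0⟩ := cross_zero hcon st1
    have := st2 _ (sseg_sub hy (sseg_r _ _) ⟨τ, τ0, τ1.le, rfl⟩) hc0
    simp only at this
    have e : (y.1 + τ * ((l B).p.1 - y.1) - p.1) * (s.1 - p.1) =
      (1 - τ) * ((y.1 - p.1) * (s.1 - p.1)) + τ * (((l B).p.1 - p.1) * (s.1 - p.1)) := by ring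
    rw [e] at this
    nlinarith
  rcases le_or_gt 0 (((l B).s.1 - p.1) * (s.1 - p.1)) with hD | hD
  · obtain ⟨z, hz, hz1⟩ := sseg_x (a := (l B).s) (b := (l B).p) (c := p.1)
      (by rw [mul_comm]; exact sign_tr sc0 st3 hD)
    have := st4 z hz (by rw [hz1]; simp)
    rw [fx z hz1] at this
    have : h.2 < z.2 := by by_contra hc; push Not at hc; nlinarith
    exact S.adjd A B hB z (Or.inl (inA z (S.conv _ hsB _ hpB _ hz) hz1 (by linarith))) (Or.inr hz)
  · have f5 := st4 _ (sseg_l _ _) hD.le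
    obtain ⟨z, hz, hz1⟩ := sseg_x (a := s) (b := (l B).s) (c := p.1)
      (by rw [mul_comm]; exact sign_tr sc0 hD.le (mul_self_nonneg _))
    have hzC := S.conv _ hsr _ hsB _ hz
    obtain ⟨τ, τ0, τ1, e⟩ := id hz
    have : d * cross2 s q z = τ * (d * cross2 s q (l B).s) := by
      rw [e]; unfold cross2; simp only; ring
    rw [fx z hz1] at this
    have : h.2 ≤ z.2 := by
      by_contra hc; push Not at hc
      have := mul_nonneg τ0 f5.le
      nlinarith
    exact S.hull A r B z hz (inA z hzC hz1 (by linarith))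

end StaircaseCore3b

section StaircaseCore3c

variable {ι : Type} {C I : Set Pt} {l : ι → BLab} {adj : ι → ι → Prop}

lemma Sys.segI (S : Sys C I l adj) {s u z : Pt} (hs : s ∈ I) (hu : u ∈ C) (h : SSeg s u z)
    (hne : z ≠ u) : z ∈ I := by
  obtain ⟨t, t0, t1, e⟩ := h
  rcases t0.lt_or_eq with h' | h'
  · rcases t1.lt_or_eq with h'' | h''
    · exact S.Iseg s hs u hu z ⟨t, h', h'', e⟩
    · exact (hne (by rw [e, h'']; ext <;> simp)).elim
  · have : z = s := by rw [e, ← h']; ext <;> simp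
    rw [this]; exact hs

lemma Sys.boxCL (S : Sys C I l adj) {i : ι} (hL : (l i).left = true) {z : Pt} (hz : z ∈ C)
    (hb : (l i).inBox z) : z.1 = (l i).p.1 := by
  obtain ⟨b1, b2, b3, b4⟩ := hb
  obtain ⟨pb, lm⟩ := S.hl i hL
  by_contra hne
  have hlt : z.1 < (l i).p.1 := lt_of_le_of_ne (by linarith) hne
  rcases lt_trichotomy z.2 (l i).p.2 with h | h | h
  · exact S.K2 hL (by linarith) (by linarith) hz h hlt
  · have := lm z hz h; linarith
  · exact S.K1 hL (by linarith) (by linarith) hz h hlt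

lemma Sys.boxC (S : Sys C I l adj) {i : ι} {z : Pt} (hz : z ∈ C)
    (hb : (l i).inBox z) : z.1 = (l i).p.1 := by
  by_cases hL : (l i).left = true
  · exact S.boxCL hL hz hb
  · have := S.mX.boxCL (i := i) (z := mx z) (by simpa [BLab.mX] using hL) (by simpa using hz)
      (inBox_mX' hb)
    simpa [BLab.mX] using this

lemma Sys.T_badC (S : Sys C I l adj) {A r : ι} (hA : (l A).left = true) (hz : (l A).a = (l A).b)
    {w : Pt} (hw : w ∈ C) (hw1 : w.1 < (l A).p.1) (hw2 : w.2 < (l A).p.2)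
    (hne : A ≠ r) {z : Pt} (hzC : z ∈ C) (zA : (l A).inBox z) (zr : (l r).inBox z) : False := by
  have up := S.upA hA hw hw1 hw2
  have s1 : ∀ k, A ≠ k → ∀ h, SSeg (l k).s (l k).p h → (l A).inBox h → False :=
    fun k hk h h1 h2 => S.step1 hA hz hw hw1 hw2 hk h1 h2
  have hn : ¬ adj r A := fun ha => S.adjd r A ha z (Or.inl zr) (Or.inl zA)
  obtain ⟨pb, -⟩ := S.hl A hA
  have Alp := S.lp A
  have Aph := S.ph A
  have inA : ∀ z ∈ C, z.1 = (l A).p.1 → (l A).lo ≤ z.2 → (l A).inBox z := fun z hzC hz1 hz2 =>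
    ⟨by linarith, by linarith, hz2, by have := up z hzC hz1.le; linarith⟩
  have zc := S.boxC hzC zA
  have zc' := S.boxC hzC zr
  have hrc : (l r).p.1 = (l A).p.1 := by rw [← zc, zc']
  have hrlo : (l r).p.2 < (l A).lo := by
    by_contra hc; push Not at hc
    exact s1 r hne _ (sseg_r _ _) (inA _ (S.pC r) hrc hc)
  obtain ⟨a1, a2, a3, a4⟩ := zA
  obtain ⟨r1, r2, r3, r4⟩ := zr
  have rlp := S.lp r
  have cov : ∀ y ∈ C, y.1 = (l A).p.1 → (l r).p.2 ≤ y.2 → (l r).inBox y ∨ (l A).inBox y := by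
    intro y hy h1 h2
    by_cases h3 : y.2 ≤ z.2
    · left; exact ⟨by linarith, by linarith, by linarith, by linarith⟩
    · right; exact inA y hy h1 (by linarith)
  have V : ∀ y ∈ I, y.1 = (l A).p.1 → (l r).inBox y ∨ (l A).inBox y := by
    intro y hy h1
    refine cov y (S.IC _ hy) h1 ?_
    by_contra hc; push Not at hc
    refine S.pI r (S.Iseg y hy _ (S.pC A) _ ⟨((l r).p.2 - y.2) / ((l A).p.2 - y.2),
      div_pos (by linarith) (by linarith), by rw [div_lt_one (by linarith)]; linarith, ?_⟩)
    have e : ((l r).p.2 - y.2) / ((l A).p.2 - y.2) * ((l A).p.2 - y.2) = (l r).p.2 - y.2 :=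
      div_mul_cancel₀ _ (by intro h; linarith)
    ext
    · simp only [h1, hrc]; ring
    · simp only [e]; ring
  have site : ∀ k, (l k).s.1 ≠ (l A).p.1 := by
    intro k h
    rcases V _ (S.sI k) h with h' | h'
    · exact S.hull r k k _ (sseg_l _ _) h'
    · exact S.hull A k k _ (sseg_l _ _) h'
  have same : ∀ j k, ((l j).s.1 - (l A).p.1) * ((l k).s.1 - (l A).p.1) ≤ 0 → False := by
    intro j k h
    obtain ⟨y, hy, hyc⟩ := sseg_x h
    have hyI := S.segI (S.sI j) (S.IC _ (S.sI k)) hy (fun e => site k (by rw [← e]; exact hyc))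
    rcases V _ hyI hyc with h' | h'
    · exact S.hull r j k _ hy h'
    · exact S.hull A j k _ hy h'
  have ldr : ∀ k, adj r k → (l k).p.1 ≠ (l A).p.1 →
      ((l k).s.1 - (l A).p.1) * ((l k).p.1 - (l A).p.1) ≤ 0 → False := by
    intro k hk hkp h
    have hkA : A ≠ k := fun h => hn (h ▸ hk)
    obtain ⟨y, hy, hyc⟩ := sseg_x h
    have hyI := S.segI (S.sI k) (S.pC k) hy (fun e => hkp (by rw [← e]; exact hyc))
    rcases V _ hyI hyc with h' | h'
    · exact S.adjd r k hk y (Or.inl h') (Or.inr hy)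
    · exact s1 k hkA y hy h'
  obtain ⟨b, b', hb, hb', h3⟩ := S.F r A hne.symm hn
  rcases h3 with ⟨h3, h4⟩ | ⟨h3, h4⟩
  · unfold cross2 at h3 h4
    rw [hrc] at h3 h4
    have q1 : (l b).p.1 < (l A).p.1 := by by_contra hc; push Not at hc; nlinarith
    have q2 : (l A).p.1 < (l b').p.1 := by by_contra hc; push Not at hc; nlinarith
    rcases le_or_gt (l A).p.1 (l b).s.1 with h | h
    · exact ldr b hb q1.ne (mul_nonpos_of_nonneg_of_nonpos (by linarith) (by linarith))
    · rcases le_or_gt (l A).p.1 (l b').s.1 with h' | h'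
      · exact same b b' (mul_nonpos_of_nonpos_of_nonneg (by linarith) (by linarith))
      · exact ldr b' hb' q2.ne' (mul_nonpos_of_nonpos_of_nonneg (by linarith) (by linarith))
  · have hkA : A ≠ b := fun h => hn (h ▸ hb)
    obtain ⟨t, t0, t1, e⟩ := h3
    have e1 : (l b).p.1 = (l A).p.1 := by rw [e]; simp [hrc]
    have e2 : (l r).p.2 ≤ (l b).p.2 := by rw [e]; simp only; nlinarith
    rcases cov _ (S.pC b) e1 e2 with h' | h'
    · exact S.adjd r b hb _ (Or.inl h') (Or.inr (sseg_r _ _))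
    · exact s1 b hkA _ (sseg_r _ _) h'

lemma Sys.T_bad [Finite ι] (S : Sys C I l adj) {A r : ι} (hA : (l A).left = true)
    (hz : (l A).a = (l A).b)
    {w : Pt} (hw : w ∈ C) (hw1 : w.1 < (l A).p.1) (hw2 : w.2 < (l A).p.2)
    (hne : A ≠ r) {z : Pt} (zA : (l A).inBox z) (zr : (l r).inBox z) : False := by
  have up := S.upA hA hw hw1 hw2
  have s1 : ∀ k, A ≠ k → ∀ h, SSeg (l k).s (l k).p h → (l A).inBox h → False :=
    fun k hk h h1 h2 => S.step1 hA hz hw hw1 hw2 hk h1 h2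
  have TC : ∀ z ∈ C, (l A).inBox z → (l r).inBox z → False := fun z h1 h2 h3 =>
    S.T_badC hA hz hw hw1 hw2 hne h1 h2 h3
  have hn : ¬ adj A r := fun ha => S.adjd A r ha z (Or.inl zA) (Or.inl zr)
  obtain ⟨pb, lm⟩ := S.hl A hA
  have Alp := S.lp A
  have Aph := S.ph A
  have rlp := S.lp r
  have rph := S.ph r
  have inA : ∀ z ∈ C, z.1 = (l A).p.1 → (l A).lo ≤ z.2 → (l A).inBox z := fun z hzC hz1 hz2 =>
    ⟨by linarith, by linarith, hz2, by have := up z hzC hz1.le; linarith⟩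
  obtain ⟨a1, a2, a3, a4⟩ := id zA
  obtain ⟨r1, r2, r3, r4⟩ := id zr
  have zc : z.1 = (l A).p.1 := by linarith
  have hchain : (l r).left = true → (l A).p.2 < (l r).p.2 → False := by
    intro hrL hlt
    obtain ⟨w0, hw0, hm⟩ := S.xmin
    have := S.mY.chainL (i := r) (j := A) hrL hA
      ⟨my w0, by simpa using hw0, fun u hu => by simpa using hm _ hu, by
        have := up w0 hw0 (by have := hm w hw; linarith)
        simpa [BLab.mY] using this⟩ (by simpa [BLab.mY] using hlt)
    simp only [BLab.mY] at this
    obtain ⟨-, h | h⟩ := this <;> linarith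
  rcases le_or_gt (l A).p.2 z.2 with hge | hlt
  · rcases le_or_gt (l r).p.2 (l A).p.2 with h | h
    · exact TC _ (S.pC A) (inA _ (S.pC A) rfl Alp) ⟨by linarith, by linarith, by linarith, by linarith⟩
    · by_cases hrL : (l r).left = true
      · exact hchain hrL h
      · have := (S.hr r (by simpa using hrL)).1
        have := up _ (S.pC r) (by linarith)
        linarith
  · by_cases hzC : z ∈ C
    · exact TC z hzC zA zr
    have all : ∀ y ∈ C, y.1 = (l A).p.1 → (l A).inBox y := by
      intro y hy h1
      refine inA y hy h1 ?_
      by_contra hc; push Not at hc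
      apply hzC
      refine S.conv y hy _ (S.pC A) z ?_
      obtain ⟨x, hx, hx2⟩ := sseg_y (a := y) (b := (l A).p) (c := z.2)
        (mul_nonpos_of_nonpos_of_nonneg (by linarith) (by linarith))
      have h3 := sseg_x_le hx h1.le le_rfl
      have h4 := sseg_le_x hx h1.ge le_rfl
      have : z = x := by ext; linarith; exact hx2.symm
      rw [this]; exact hx
    have same : ∀ j k, ((l j).s.1 - (l A).p.1) * ((l k).s.1 - (l A).p.1) ≤ 0 → False := by
      intro j k h
      obtain ⟨y, hy, hyc⟩ := sseg_x h
      exact S.hull A j k _ hy (all y (S.conv _ (S.IC _ (S.sI j)) _ (S.IC _ (S.sI k)) _ hy) hyc)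
    have ldr : ∀ k, A ≠ k → ((l k).s.1 - (l A).p.1) * ((l k).p.1 - (l A).p.1) ≤ 0 → False := by
      intro k hk h
      obtain ⟨y, hy, hyc⟩ := sseg_x h
      exact s1 k hk y hy (all y (S.conv _ (S.IC _ (S.sI k)) _ (S.pC k) _ hy) hyc)
    have bar : (l r).inBox ((l A).p.1, z.2) := ⟨by simp only; linarith, by simp only; linarith, r3, r4⟩
    by_cases hrL : (l r).left = true
    · have rb := (S.hl r hrL).1
      have rlm := (S.hl r hrL).2
      rcases le_or_gt (l r).p.1 (l A).p.1 with h | h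
      · exact ldr r hne (by
          have : (l r).p.1 - (l A).p.1 = 0 := by linarith
          rw [this]; simp)
      have hrs : (l A).p.1 < (l r).s.1 := by
        by_contra hc; push Not at hc
        exact ldr r hne (mul_nonpos_of_nonpos_of_nonneg (by linarith) (by linarith))
      have hall : ∀ k, k ≠ A → (l A).p.1 < (l k).p.1 := by
        intro k hk
        by_contra hc; push Not at hc
        rcases le_or_gt (l A).p.1 (l k).s.1 with h' | h'
        · exact ldr k hk.symm (mul_nonpos_of_nonneg_of_nonpos (by linarith) (by linarith))
        · exact same r k (mul_nonpos_of_nonneg_of_nonpos (by linarith) (by linarith))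
      rcases lt_trichotomy (l r).p.2 (l A).p.2 with h' | h' | h'
      · exact S.T_end hz (by linarith) hrL hne hn bar a3 hlt hall h'
      · have := rlm _ (S.pC A) h'.symm; linarith
      · exact hchain hrL h'
    · have hrL : (l r).left = false := by simpa using hrL
      have rb := (S.hr r hrL).1
      have rlm := (S.hr r hrL).2
      rcases le_or_gt (l A).p.1 (l r).p.1 with h | h
      · exact ldr r hne (by
          have : (l r).p.1 - (l A).p.1 = 0 := by linarith
          rw [this]; simp)
      have hrs : (l r).s.1 < (l A).p.1 := by
        by_contra hc; push Not at hc
        exact ldr r hne (mul_nonpos_of_nonneg_of_nonpos (by linarith) (by linarith))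
      have hall : ∀ k, k ≠ A → (l k).p.1 < (l A).p.1 := by
        intro k hk
        by_contra hc; push Not at hc
        rcases le_or_gt (l k).s.1 (l A).p.1 with h' | h'
        · exact ldr k hk.symm (mul_nonpos_of_nonpos_of_nonneg (by linarith) (by linarith))
        · exact same r k (mul_nonpos_of_nonpos_of_nonneg (by linarith) (by linarith))
      have hlt2 : (l r).p.2 < (l A).p.2 := by
        rcases (up _ (S.pC r) h.le).lt_or_eq with h' | h'
        · exact h'
        · have := rlm _ (S.pC A) h'.symm; linarith
      have bar2 : ((l r).mX).inBox (((l A).mX).p.1, z.2) :=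
        inBox_mX' (z := ((l A).p.1, z.2)) bar
      exact S.mX.T_end (A := A) (r := r) (by simp [BLab.mX, hz]) (by simp [BLab.mX]; linarith)
        (by simp [BLab.mX, hrL]) hne hn bar2 a3 hlt
        (fun k hk => by have := hall k hk; simpa [BLab.mX] using this) hlt2

end StaircaseCore3c

section StaircaseCore3d

variable {ι : Type} {C I : Set Pt} {l : ι → BLab} {adj : ι → ι → Prop}

lemma Sys.loL [Finite ι] (S : Sys C I l adj) {i j : ι} (hL : (l i).left = true) {u : Pt} (hu : u ∈ C)
    (h1 : u.1 < (l i).p.1) (h2 : u.2 < (l i).p.2) (hij : i ≠ j) {z : Pt} (zi : (l i).inBox z)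
    (zj : (l j).inBox z) : (l i).p.2 ≤ z.2 := by
  by_contra hc; push Not at hc
  rcases (S.ab i).lt_or_eq with h | h
  · exact S.K2 hL h (lt_of_le_of_lt zi.2.2.1 hc) hu h2 h1
  · exact S.T_bad hL h hu h1 h2 hij zi zj

lemma Sys.hiL [Finite ι] (S : Sys C I l adj) {i j : ι} (hL : (l i).left = true) {u : Pt} (hu : u ∈ C)
    (h1 : u.1 < (l i).p.1) (h2 : (l i).p.2 < u.2) (hij : i ≠ j) {z : Pt} (zi : (l i).inBox z)
    (zj : (l j).inBox z) : z.2 ≤ (l i).p.2 := by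
  have := S.mY.loL (i := i) (j := j) hL (u := my u) (by simpa using hu) (by simpa [BLab.mY] using h1)
    (by simpa [BLab.mY] using h2) hij (inBox_mY' zi) (inBox_mY' zj)
  simpa [BLab.mY] using this

lemma Sys.loR [Finite ι] (S : Sys C I l adj) {i j : ι} (hL : (l i).left = false) {u : Pt} (hu : u ∈ C)
    (h1 : (l i).p.1 < u.1) (h2 : u.2 < (l i).p.2) (hij : i ≠ j) {z : Pt} (zi : (l i).inBox z)
    (zj : (l j).inBox z) : (l i).p.2 ≤ z.2 := by
  have := S.mX.loL (i := i) (j := j) (by simp [BLab.mX, hL]) (u := mx u) (by simpa using hu)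
    (by simpa [BLab.mX] using h1)
    (by simpa [BLab.mX] using h2) hij (inBox_mX' zi) (inBox_mX' zj)
  simpa [BLab.mX] using this

lemma Sys.hiR [Finite ι] (S : Sys C I l adj) {i j : ι} (hL : (l i).left = false) {u : Pt} (hu : u ∈ C)
    (h1 : (l i).p.1 < u.1) (h2 : (l i).p.2 < u.2) (hij : i ≠ j) {z : Pt} (zi : (l i).inBox z)
    (zj : (l j).inBox z) : z.2 ≤ (l i).p.2 := by
  have := S.mX.hiL (i := i) (j := j) (by simp [BLab.mX, hL]) (u := mx u) (by simpa using hu)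
    (by simpa [BLab.mX] using h1)
    (by simpa [BLab.mX] using h2) hij (inBox_mX' zi) (inBox_mX' zj)
  simpa [BLab.mX] using this

lemma Sys.LL1 [Finite ι] (S : Sys C I l adj) {i j : ι} (hi : (l i).left = true)
    (hj : (l j).left = true) (hij : i ≠ j) (hlt : (l i).p.2 < (l j).p.2) {z : Pt}
    (zi : (l i).inBox z) (zj : (l j).inBox z) : False := by
  obtain ⟨a1, a2, a3, a4⟩ := id zi
  obtain ⟨r1, r2, r3, r4⟩ := id zj
  have low : LowL C (l j) → False := by
    intro h
    obtain ⟨-, h | h⟩ := S.chainL hi hj h hlt <;> linarith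
  have upp : ∀ w ∈ C, (∀ u ∈ C, w.1 ≤ u.1) → w.2 ≤ (l i).p.2 → False := by
    intro w hw hm h
    have := S.mY.chainL (i := j) (j := i) hj hi
      ⟨my w, by simpa using hw, fun u hu => by simpa using hm _ hu, by simpa [BLab.mY] using h⟩
      (by simpa [BLab.mY] using hlt)
    simp only [BLab.mY] at this
    obtain ⟨-, h | h⟩ := this <;> linarith
  obtain ⟨w, hw, hm⟩ := S.xmin
  rcases le_or_gt w.2 (l i).p.2 with h | h
  · exact upp w hw hm h
  rcases le_or_gt (l j).p.2 w.2 with h' | h'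
  · exact low ⟨w, hw, hm, h'⟩
  rcases (hm _ (S.pC i)).lt_or_eq with e | e
  · rcases (hm _ (S.pC j)).lt_or_eq with e' | e'
    · have := S.hiL hi hw e h hij zi zj
      have := S.loL hj hw e' h' hij.symm zj zi
      linarith
    · exact low ⟨_, S.pC j, fun u hu => by rw [← e']; exact hm u hu, le_rfl⟩
  · exact upp _ (S.pC i) (fun u hu => by rw [← e]; exact hm u hu) le_rfl

lemma Sys.LL [Finite ι] (S : Sys C I l adj) {i j : ι} (hi : (l i).left = true)
    (hj : (l j).left = true) (hij : i ≠ j) {z : Pt}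
    (zi : (l i).inBox z) (zj : (l j).inBox z) : False := by
  rcases lt_trichotomy (l i).p.2 (l j).p.2 with h | h | h
  · exact S.LL1 hi hj hij h zi zj
  · have h1 := (S.hl i hi).2 _ (S.pC j) h.symm
    have h2 := (S.hl j hj).2 _ (S.pC i) h
    exact S.pne hij (by ext; linarith; exact h)
  · exact S.LL1 hj hi hij.symm h zj zi

lemma Sys.LReq [Finite ι] (S : Sys C I l adj) {i j : ι} (hi : (l i).left = true)
    (hj : (l j).left = false) (hij : i ≠ j) (he : (l j).p.1 = (l i).p.1)
    (hlt : (l j).p.2 < (l i).p.2) {z : Pt}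
    (zi : (l i).inBox z) (zj : (l j).inBox z) : False := by
  obtain ⟨a1, a2, a3, a4⟩ := id zi
  obtain ⟨r1, r2, r3, r4⟩ := id zj
  obtain ⟨ib, ilm⟩ := S.hl i hi
  obtain ⟨jb, jrm⟩ := S.hr j hj
  have ilp := S.lp i
  have iph := S.ph i
  have jlp := S.lp j
  have jph := S.ph j
  have hn : ¬ adj i j := fun h => S.adjd i j h z (Or.inl zi) (Or.inl zj)
  have hn' : ¬ adj j i := fun h => hn (S.adjs _ _ h)
  have W : ∀ w ∈ C, w.1 < (l i).p.1 → (l i).p.2 ≤ z.2 := by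
    intro w hw h1
    refine S.loL hi hw h1 ?_ hij zi zj
    by_contra hc; push Not at hc
    exact LMs S.cc ilm hw (S.pC j) h1 he.le
      (mul_nonpos_of_nonneg_of_nonpos (by linarith) (by linarith)) hlt.ne
  have W' : ∀ w ∈ C, (l i).p.1 < w.1 → z.2 ≤ (l j).p.2 := by
    intro w hw h1
    refine S.hiR hj hw (by linarith) ?_ hij.symm zj zi
    by_contra hc; push Not at hc
    exact RMs S.cc jrm hw (S.pC i) (by linarith) he.le
      (mul_nonpos_of_nonpos_of_nonneg (by linarith) (by linarith)) hlt.ne'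
  by_cases hw : ∃ w ∈ C, w.1 < (l i).p.1
  · obtain ⟨w, hwC, hw1⟩ := hw
    have h1 := W w hwC hw1
    have hle : ∀ u ∈ C, u.1 ≤ (l i).p.1 := by
      intro u hu
      by_contra hc; push Not at hc
      have := W' u hu hc
      linarith
    obtain ⟨b, b', hb, hb', h3⟩ := S.F j i hij.symm hn'
    rcases h3 with ⟨h3, h4⟩ | ⟨h3, h4⟩
    · unfold cross2 at h4
      rw [he] at h4
      have := hle _ (S.pC b')
      nlinarith
    · obtain ⟨t, t0, t1, e⟩ := id h3
      have e1 : (l b).p.1 = (l i).p.1 := by rw [e]; simp [he]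
      have e2 : (l j).p.2 ≤ (l b).p.2 := by rw [e]; simp only; nlinarith
      have e3 : (l b).p.2 ≤ (l i).p.2 := by rw [e]; simp only; nlinarith
      exact S.adjd j b hb _ (Or.inl ⟨by linarith, by linarith, by linarith, by linarith⟩)
        (Or.inr (sseg_r _ _))
  · push Not at hw
    obtain ⟨u, huC, -, hu1⟩ := S.Ir _ (S.sI i)
    have := hw _ (S.IC _ (S.sI i))
    have h1 := W' u huC (by linarith)
    obtain ⟨b, b', hb, hb', h3⟩ := S.F i j hij hn
    rcases h3 with ⟨h3, h4⟩ | ⟨h3, h4⟩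
    · unfold cross2 at h4
      rw [he] at h4
      have := hw _ (S.pC b')
      nlinarith
    · obtain ⟨t, t0, t1, e⟩ := id h3
      have e1 : (l b).p.1 = (l i).p.1 := by rw [e]; simp [he]
      have e2 : (l j).p.2 ≤ (l b).p.2 := by rw [e]; simp only; nlinarith
      have e3 : (l b).p.2 ≤ (l i).p.2 := by rw [e]; simp only; nlinarith
      exact S.adjd i b hb _ (Or.inl ⟨by linarith, by linarith, by linarith, by linarith⟩)
        (Or.inr (sseg_r _ _))

lemma Sys.LR [Finite ι] (S : Sys C I l adj) {i j : ι} (hi : (l i).left = true)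
    (hj : (l j).left = false) (hij : i ≠ j) {z : Pt}
    (zi : (l i).inBox z) (zj : (l j).inBox z) : False := by
  obtain ⟨a1, a2, a3, a4⟩ := id zi
  obtain ⟨r1, r2, r3, r4⟩ := id zj
  obtain ⟨ib, ilm⟩ := S.hl i hi
  obtain ⟨jb, jrm⟩ := S.hr j hj
  have hle : (l j).p.1 ≤ (l i).p.1 := by linarith
  rcases hle.lt_or_eq with h | h
  · rcases lt_trichotomy (l i).p.2 (l j).p.2 with h' | h' | h'
    · have := S.hiL hi (S.pC j) h h' hij zi zj
      have := S.loR hj (S.pC i) h h' hij.symm zj zi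
      linarith
    · have := ilm _ (S.pC j) h'.symm; linarith
    · have := S.loL hi (S.pC j) h h' hij zi zj
      have := S.hiR hj (S.pC i) h h' hij.symm zj zi
      linarith
  · rcases lt_trichotomy (l i).p.2 (l j).p.2 with h' | h' | h'
    · exact S.mY.LReq (i := i) (j := j) hi hj hij h (by simpa [BLab.mY] using h')
        (inBox_mY' zi) (inBox_mY' zj)
    · exact S.pne hij (by ext; exact h.symm; exact h')
    · exact S.LReq hi hj hij h h' zi zj

theorem Sys.bb [Finite ι] (S : Sys C I l adj) {i j : ι} (hij : i ≠ j) {z : Pt}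
    (zi : (l i).inBox z) (zj : (l j).inBox z) : False := by
  cases hi : (l i).left <;> cases hj : (l j).left
  · exact S.mX.LL (i := i) (j := j) (by simp [BLab.mX, hi]) (by simp [BLab.mX, hj]) hij
      (inBox_mX' zi) (inBox_mX' zj)
  · exact S.LR hj hi hij.symm zj zi
  · exact S.LR hi hj hij zi zj
  · exact S.LL hi hj hij zi zj

lemma Sys.ownbox (S : Sys C I l adj) (i : ι) : (l i).inBox (l i).p := by
  have := S.ab i
  refine ⟨?_, ?_, S.lp i, S.ph i⟩ <;> cases hi : (l i).left
  · exact (S.hr i hi).1.ge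
  · have := (S.hl i hi).1; linarith
  · have := (S.hr i hi).1; linarith
  · exact (S.hl i hi).1.le

lemma Sys.bl1 (S : Sys C I l adj) {i j : ι} (hi : (l i).left = true) (hij : i ≠ j) {z : Pt}
    (zI : z ∈ I) (zi : (l i).inBox z) (zj : SSeg (l j).s (l j).p z) (hlt : z.2 < (l i).p.2) :
    False := by
  have hzc := S.boxC (S.IC _ zI) zi
  obtain ⟨u, hu, h2, h1⟩ := S.Il z zI
  rcases (S.ab i).lt_or_eq with h | h
  · exact S.K2 hi h (lt_of_le_of_lt zi.2.2.1 hlt) hu (by linarith) (by linarith)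
  · exact S.step1 hi h hu (by linarith) (by linarith) hij zj zi

lemma Sys.bl2 (S : Sys C I l adj) {i j : ι} (hi : (l i).left = true) (hij : i ≠ j) {z : Pt}
    (zI : z ∈ I) (zi : (l i).inBox z) (zj : SSeg (l j).s (l j).p z) : False := by
  have hzc := S.boxC (S.IC _ zI) zi
  rcases lt_trichotomy z.2 (l i).p.2 with h | h | h
  · exact S.bl1 hi hij zI zi zj h
  · have : z = (l i).p := by ext; exact hzc; exact h
    exact S.pI i (this ▸ zI)
  · exact S.mY.bl1 (i := i) (j := j) (z := my z) hi hij (by simpa using zI) (inBox_mY' zi)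
      (sseg_my (a := my (l j).s) (b := my (l j).p) (by simpa using zj)) (by simpa [BLab.mY] using h)

theorem Sys.blead [Finite ι] (S : Sys C I l adj) {i j : ι} (hij : i ≠ j) {z : Pt}
    (zi : (l i).inBox z) (zj : SSeg (l j).s (l j).p z) : False := by
  by_cases he : z = (l j).p
  · exact S.bb hij zi (he ▸ S.ownbox j)
  have zI := S.segI (S.sI j) (S.pC j) zj he
  cases hi : (l i).left
  · exact S.mX.bl2 (i := i) (j := j) (z := mx z) (by simp [BLab.mX, hi]) hij (by simpa using zI)
      (inBox_mX' zi) (sseg_mx (a := mx (l j).s) (b := mx (l j).p) (by simpa using zj))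
  · exact S.bl2 hi hij zI zi zj

theorem Sys.main [Finite ι] (S : Sys C I l adj) {i j : ι} (hij : i ≠ j) {z : Pt}
    (zi : (l i).inT z) (zj : (l j).inT z) : False := by
  rcases zi with zi | zi <;> rcases zj with zj | zj
  · exact S.bb hij zi zj
  · exact S.blead hij zi zj
  · exact S.blead hij.symm zj zi
  · exact S.lead i j hij z zi zj

end StaircaseCore3d

section StaircaseCore4a

def RBtw (x y z : ℝ) : Prop := (x < y ∧ y < z) ∨ (z < y ∧ y < x)

def Diag (p q m m' : Pt) : Prop :=
  (0 < cross2 p q m ∧ cross2 p q m' < 0) ∨ (0 < cross2 p q m' ∧ cross2 p q m < 0) ∨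
  (OSeg p q m ∧ ¬ OSeg p q m') ∨ (OSeg p q m' ∧ ¬ OSeg p q m)

lemma Diag.symm {p q m m' : Pt} (h : Diag p q m m') : Diag q p m m' := by
  have e : ∀ x, cross2 q p x = - cross2 p q x := fun x => by unfold cross2; ring
  have e2 : ∀ x, OSeg q p x ↔ OSeg p q x := fun x => ⟨oseg_symm, oseg_symm⟩
  unfold Diag at *
  simp only [e, e2, Left.neg_pos_iff, Left.neg_neg_iff]
  tauto

lemma line_param' {u v x : Pt} (huv : u ≠ v) (h : cross2 u v x = 0) :
    ∃ t : ℝ, x = (u.1 + t * (v.1 - u.1), u.2 + t * (v.2 - u.2)) := by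
  by_cases h1 : v.1 - u.1 = 0
  · rcases lt_trichotomy u.2 v.2 with h2 | h2 | h2
    · exact line_param h2 h
    · exact (huv (by ext; linarith; exact h2)).elim
    · obtain ⟨t, ht⟩ := line_param (u := v) (v := u) (x := x) h2 (by
        unfold cross2 at h ⊢; linarith)
      refine ⟨1 - t, ?_⟩
      rw [ht]; ext <;> simp only <;> ring
  · exact line_param_x h1 h

/-- collinear with no strict betweenness gives betweenness at an end -/
lemma tri_split {a c b : Pt} (hac : a ≠ c) (hba : b ≠ a) (hbc : b ≠ c) (h : cross2 a c b = 0)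
    (ho : ¬ OSeg a c b) : OSeg b c a ∨ OSeg a b c := by
  obtain ⟨t, ht⟩ := line_param' hac h
  rcases lt_trichotomy t 0 with h0 | h0 | h0
  · left
    have h1t : 0 < 1 - t := by linarith
    refine ⟨-t / (1 - t), by apply div_pos <;> linarith, by rw [div_lt_one h1t]; linarith, ?_⟩
    rw [ht]
    ext <;> simp only <;> field_simp <;> ring
  · exact (hba (by rw [ht, h0]; ext <;> simp)).elim
  · rcases lt_trichotomy t 1 with h1 | h1 | h1
    · exact (ho ⟨t, h0, h1, ht⟩).elim
    · exact (hbc (by rw [ht, h1]; ext <;> simp)).elim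
    · right
      refine ⟨1 / t, by positivity, by rw [div_lt_one h0]; exact h1, ?_⟩
      rw [ht]
      ext <;> simp only <;> field_simp <;> ring

lemma quad {a b c d : Pt} (hab : a ≠ b) (hac : a ≠ c) (had : a ≠ d) (hbc : b ≠ c) (hcd : c ≠ d)
    (h1 : cross2 a b c ≤ 0) (h2 : cross2 a b d ≤ 0) (h3 : cross2 a c d ≤ 0)
    (h4 : cross2 b c d ≤ 0) :
    Diag a c b d ∨ (cross2 a c b = 0 ∧ cross2 a c d = 0) := by
  have e1 : cross2 a c b = - cross2 a b c := by unfold cross2; ring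
  by_cases hs : 0 < cross2 a c b ∧ cross2 a c d < 0
  · exact Or.inl (Or.inl hs)
  by_cases hb : cross2 a c b = 0
  · by_cases ho : OSeg a c b
    · by_cases ho' : OSeg a c d
      · exact Or.inr ⟨hb, cross_oseg ho'⟩
      · exact Or.inl (Or.inr (Or.inr (Or.inl ⟨ho, ho'⟩)))
    · right
      refine ⟨hb, ?_⟩
      rcases tri_split hac hab.symm hbc hb ho with h | h
      · obtain ⟨t, t0, t1, e⟩ := h
        have k : (1 - t) * cross2 a b d + t * cross2 a c d = 0 := by
          rw [e]; unfold cross2; simp only; ring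
        nlinarith
      · obtain ⟨t, t0, t1, e⟩ := h
        have k : (1 - t) * cross2 a c d + t * cross2 b c d = 0 := by
          rw [e]; unfold cross2; simp only; ring
        nlinarith
  · have hb' : 0 < cross2 a c b := lt_of_le_of_ne (by linarith) (Ne.symm hb)
    have hd : cross2 a c d = 0 := by
      by_contra hc
      exact hs ⟨hb', lt_of_le_of_ne h3 hc⟩
    by_cases ho : OSeg a c d
    · exact Or.inl (Or.inr (Or.inr (Or.inr ⟨ho, fun h => hb (cross_oseg h)⟩)))
    · exfalso
      rcases tri_split hac had.symm hcd.symm hd ho with h | h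
      · obtain ⟨t, t0, t1, e⟩ := h
        have k : (1 - t) * cross2 a b d + t * cross2 a b c = 0 := by
          rw [e]; unfold cross2; simp only; ring
        nlinarith
      · obtain ⟨t, t0, t1, e⟩ := h
        have k : (1 - t) * cross2 a b c + t * cross2 b c d = 0 := by
          rw [e]; unfold cross2; simp only; ring
        nlinarith

lemma oseg_btw {a c b : Pt} (hac : a.2 ≠ c.2) (h : cross2 a c b = 0) :
    OSeg a c b ↔ RBtw a.2 b.2 c.2 := by
  obtain ⟨t, ht⟩ := line_param' (fun h => hac (by rw [h])) h
  have hb : b.2 = a.2 + t * (c.2 - a.2) := by rw [ht]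
  constructor
  · rintro ⟨r, r0, r1, e⟩
    rw [e]; unfold RBtw; simp only
    rcases lt_or_gt_of_ne hac with h' | h'
    · left; constructor <;> nlinarith
    · right; constructor <;> nlinarith
  · intro hB
    refine ⟨t, ?_, ?_, ht⟩
    · by_contra hc; push Not at hc
      rcases hB with ⟨x, y⟩ | ⟨x, y⟩ <;> nlinarith
    · by_contra hc; push Not at hc
      rcases hB with ⟨x, y⟩ | ⟨x, y⟩ <;> nlinarith

end StaircaseCore4a

section StaircaseCore4b

variable {C : Set Pt}

lemma CwLT.ne {p q : Pt} (h : CwLT C p q) : p ≠ q := by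
  rintro rfl
  rcases h with ⟨_, _, h⟩ | ⟨h, _, h'⟩ | ⟨_, _, _, _, h⟩
  · exact lt_irrefl _ h
  · exact h' h
  · exact lt_irrefl _ h

lemma CwLT.tr {p q r : Pt} (h : CwLT C p q) (h' : CwLT C q r) : CwLT C p r := by
  rcases h with ⟨a1, a2, a3⟩ | ⟨a1, a2, a3⟩ | ⟨a1, a2, a3, a4, a5⟩ <;>
  rcases h' with ⟨b1, b2, b3⟩ | ⟨b1, b2, b3⟩ | ⟨b1, b2, b3, b4, b5⟩
  · exact Or.inl ⟨a1, b2, b3.trans a3⟩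
  · exact Or.inr (Or.inl ⟨a1, b2, b3⟩)
  · exact (b1 a2).elim
  · exact (a3 b1).elim
  · exact (a3 b1).elim
  · exact Or.inr (Or.inl ⟨a1, b3, b4⟩)
  · exact (a4 b1).elim
  · exact (a4 b1).elim
  · exact Or.inr (Or.inr ⟨a1, a2, b3, b4, a5.trans b5⟩)

lemma cross2_cyc (p q r : Pt) : cross2 q r p = cross2 p q r := by unfold cross2; ring
lemma cross2_cyc' (p q r : Pt) : cross2 r p q = cross2 p q r := by unfold cross2; ring
lemma cross2_sw (p q r : Pt) : cross2 q p r = - cross2 p q r := by unfold cross2; ring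
lemma cross2_sw' (p q r : Pt) : cross2 p r q = - cross2 p q r := by unfold cross2; ring

lemma cw_cross (hC : CConv C) {p q r : Pt} (h : CwLT C p q) (h' : CwLT C q r) :
    cross2 p q r ≤ 0 := by
  rcases h with ⟨a1, a2, a3⟩ | ⟨a1, a2, a3⟩ | ⟨a1, a2, a3, a4, a5⟩ <;>
  rcases h' with ⟨b1, b2, b3⟩ | ⟨b1, b2, b3⟩ | ⟨b1, b2, b3, b4, b5⟩
  · rw [← cross2_cyc']
    exact RM hC a2.2.2 b2.1 a1.1 b3.le a3.le (b3.trans a3)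
  · by_cases k1 : r.2 < q.2
    · rw [← cross2_cyc']
      exact RM hC a2.2.2 b2.1 a1.1 k1.le a3.le (k1.trans a3)
    · by_cases k2 : p.2 < r.2
      · rw [← cross2_cyc]
        exact RM hC a1.2.2 a2.1 b2.1 a3.le k2.le (a3.trans k2)
      · push Not at k1 k2
        have := LM hC b2.2.2 a2.1 a1.1 k1 k2 a3
        rw [cross2_sw] at this
        linarith
  · exact (b1 a2).elim
  · exact (a3 b1).elim
  · exact (a3 b1).elim
  · by_cases k1 : p.2 < q.2
    · have := LM hC a2.2.2 a1.1 b3.1 k1.le b5.le (k1.trans b5)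
      rw [cross2_sw'] at this
      linarith
    · by_cases k2 : r.2 < p.2
      · have := LM hC b3.2.2 a2.1 a1.1 b5.le k2.le (b5.trans k2)
        rw [cross2_sw] at this
        linarith
      · push Not at k1 k2
        rw [← cross2_cyc]
        exact RM hC a1.2.2 a2.1 b3.1 k1 k2 b5
  · exact (a4 b1).elim
  · exact (a4 b1).elim
  · have := LM hC a3.2.2 a2.1 b3.1 a5.le b5.le (a5.trans b5)
    rw [cross2_sw'] at this
    linarith

lemma mid_R (hC : CConv C) {x y z : Pt} {m k : ℝ} (hx : x ∈ rightChain C) (hy : y ∈ C) (hz : z ∈ C)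
    (ex : x.1 = m * x.2 + k) (ey : y.1 = m * y.2 + k) (ez : z.1 = m * z.2 + k)
    (h1 : y.2 < x.2) (h2 : x.2 < z.2) :
    (∀ w ∈ C, w.2 = y.2 → w.1 ≤ y.1) ∧ (∀ w ∈ C, w.2 = z.2 → w.1 ≤ z.1) := by
  have hc : cross2 y z x = 0 := by unfold cross2; rw [ex, ey, ez]; ring
  have ho : OSeg y z x := (oseg_btw (by intro h; linarith) hc).2 (Or.inl ⟨h1, h2⟩)
  have g := G1 hC hx.2.2 hy hz ho (h1.trans h2)
  constructor
  · intro w hw e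
    have := g w hw
    unfold cross2 at this
    rw [e] at this
    nlinarith
  · intro w hw e
    have := g w hw
    unfold cross2 at this
    rw [e] at this
    nlinarith

lemma col4 {a b c d : Pt} (hac : a ≠ c) (h1 : cross2 a c b = 0) (h2 : cross2 a c d = 0) :
    (a.2 = b.2 ∧ b.2 = c.2 ∧ c.2 = d.2) ∨
    ∃ m k, a.1 = m * a.2 + k ∧ b.1 = m * b.2 + k ∧ c.1 = m * c.2 + k ∧ d.1 = m * d.2 + k := by
  by_cases h : a.2 = c.2
  · left
    have h3 : c.1 - a.1 ≠ 0 := fun h3 => hac (by ext; linarith; exact h)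
    unfold cross2 at h1 h2
    rw [h] at h1 h2
    simp only [sub_self, zero_mul, sub_zero, mul_eq_zero, h3, false_or] at h1 h2
    refine ⟨by linarith, by linarith, by linarith⟩
  · right
    have h3 : c.2 - a.2 ≠ 0 := fun h3 => h (by linarith)
    have e : (c.1 - a.1) / (c.2 - a.2) * (c.2 - a.2) = c.1 - a.1 := div_mul_cancel₀ _ h3
    set m := (c.1 - a.1) / (c.2 - a.2)
    have key : ∀ x : Pt, cross2 a c x = 0 → x.1 = m * x.2 + (a.1 - m * a.2) := by
      intro x hx
      unfold cross2 at hx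
      rw [← e] at hx
      have : (c.2 - a.2) * (m * (x.2 - a.2) - (x.1 - a.1)) = 0 := by linarith
      rcases mul_eq_zero.1 this with h | h
      · exact (h3 h).elim
      · linarith
    refine ⟨m, a.1 - m * a.2, by ring, key _ h1, key _ (by unfold cross2; ring), key _ h2⟩

def Cyc (a b c d : ℝ) : Prop := (d < c ∧ c < b ∧ b < a) ∨ (a < b ∧ b < c ∧ c < d) ∨ (b < c ∧ c < d ∧ d < a)

lemma cw_cyc (hC : CConv C) {a b c d : Pt} (h1 : CwLT C a b) (h2 : CwLT C b c) (h3 : CwLT C c d)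
    {m k : ℝ} (ea : a.1 = m * a.2 + k) (eb : b.1 = m * b.2 + k) (ec : c.1 = m * c.2 + k)
    (ed : d.1 = m * d.2 + k) : Cyc a.2 b.2 c.2 d.2 := by
  have ne : ∀ x y : Pt, x.1 = m * x.2 + k → y.1 = m * y.2 + k → x ≠ y → x.2 ≠ y.2 := by
    intro x y hx hy hxy h
    exact hxy (by ext; rw [hx, hy, h]; exact h)
  have nab := ne _ _ ea eb h1.ne
  have nac := ne _ _ ea ec (h1.tr h2).ne
  have nad := ne _ _ ea ed ((h1.tr h2).tr h3).ne
  have nbc := ne _ _ eb ec h2.ne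
  have nbd := ne _ _ eb ed (h2.tr h3).ne
  have ncd := ne _ _ ec ed h3.ne
  -- an `R` point is not between a contour point and an `N` point
  have M : ∀ x y z : Pt, x.1 = m * x.2 + k → y.1 = m * y.2 + k → z.1 = m * z.2 + k →
      x ∈ rightChain C → y ∈ C → z ∈ leftChain C → z ∉ rightChain C →
      ¬ (y.2 < x.2 ∧ x.2 < z.2) ∧ ¬ (z.2 < x.2 ∧ x.2 < y.2) := by
    intro x y z ex ey ez hx hy hz hz'
    constructor
    · rintro ⟨k1, k2⟩
      exact hz' ⟨hz.1, hz.2.1, (mid_R hC hx hy hz.1 ex ey ez k1 k2).2⟩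
    · rintro ⟨k1, k2⟩
      exact hz' ⟨hz.1, hz.2.1, (mid_R hC hx hz.1 hy ex ez ey k1 k2).1⟩
  unfold Cyc
  rcases h1 with ⟨a1, a2, a3⟩ | ⟨a1, a2, a3⟩ | ⟨a1, a2, a3, a4, a5⟩ <;>
  rcases h2 with ⟨b1, b2, b3⟩ | ⟨b1, b2, b3⟩ | ⟨b1, b2, b3, b4, b5⟩ <;>
  first
  | exact absurd a2 b1
  | exact absurd b1 a3
  | exact absurd b1 a4
  | skip
  all_goals
    rcases h3 with ⟨c1, c2, c3⟩ | ⟨c1, c2, c3⟩ | ⟨c1, c2, c3, c4, c5⟩ <;>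
    first
    | exact absurd b2 c1
    | exact absurd c1 b3
    | exact absurd c1 b4
    | skip
  · exact Or.inl ⟨c3, b3, a3⟩
  · have m1 := M b a d eb ea ed a2 a1.1 c2 c3
    have m2 := M b c d eb ec ed a2 b2.1 c2 c3
    exfalso
    rcases lt_or_gt_of_ne nbd with h | h
    · exact m2.1 ⟨b3, h⟩
    · exact m1.2 ⟨h, a3⟩
  · right; right
    have m1 := M a b c ea eb ec a1 a2.1 b2 b3
    have m2 := M a b d ea eb ed a1 a2.1 c3 c4
    have m3 := M b a c eb ea ec a2 a1.1 b2 b3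
    refine ⟨?_, c5, ?_⟩
    · rcases lt_or_gt_of_ne nbc with h | h
      · exact h
      · exact (m3.2 ⟨h, a3⟩).elim
    · rcases lt_or_gt_of_ne nad with h | h
      · exact (m2.1 ⟨a3, h⟩).elim
      · exact h
  · right
    have m1 := M a b d ea eb ed a1 a2.1 c3 c4
    rcases lt_or_gt_of_ne nab with h | h
    · exact Or.inl ⟨h, b5, c5⟩
    · right
      refine ⟨b5, c5, ?_⟩
      rcases lt_or_gt_of_ne nad with h' | h'
      · exact (m1.1 ⟨h, h'⟩).elim
      · exact h'
  · exact Or.inr (Or.inl ⟨a5, b5, c5⟩)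

lemma cw_nohor {a b c d : Pt} (h1 : CwLT C a b) (h2 : CwLT C b c) (h3 : CwLT C c d)
    (h : a.2 = b.2 ∧ b.2 = c.2 ∧ c.2 = d.2) : False := by
  obtain ⟨e1, e2, e3⟩ := h
  rcases h2 with ⟨b1, b2, b3⟩ | ⟨b1, b2, b3⟩ | ⟨b1, b2, b3, b4, b5⟩
  · linarith
  · rcases h1 with ⟨a1, a2, a3⟩ | ⟨a1, a2, a3⟩ | ⟨a1, a2, a3, a4, a5⟩
    · linarith
    · exact a3 b1
    · linarith
  · linarith

lemma diag_col {a b c d : Pt} {m k : ℝ} (ea : a.1 = m * a.2 + k) (eb : b.1 = m * b.2 + k)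
    (ec : c.1 = m * c.2 + k) (ed : d.1 = m * d.2 + k) (hac : a.2 ≠ c.2)
    (h : (RBtw a.2 b.2 c.2 ∧ ¬ RBtw a.2 d.2 c.2) ∨ (RBtw a.2 d.2 c.2 ∧ ¬ RBtw a.2 b.2 c.2)) :
    Diag a c b d := by
  rw [← oseg_btw hac (b := b) (by unfold cross2; rw [ea, eb, ec]; ring),
    ← oseg_btw hac (b := d) (by unfold cross2; rw [ea, ed, ec]; ring)] at h
  exact Or.inr (Or.inr h)

lemma cyc1 {a b c d : ℝ} (h : Cyc a b c d) :
    a ≠ c ∧ ((RBtw a b c ∧ ¬ RBtw a d c) ∨ (RBtw a d c ∧ ¬ RBtw a b c)) := by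
  unfold Cyc at h; unfold RBtw
  rcases h with ⟨x, y, z⟩ | ⟨x, y, z⟩ | ⟨x, y, z⟩
  · refine ⟨fun h => by linarith, Or.inl ⟨by right; constructor <;> linarith, ?_⟩⟩
    rintro (⟨u, v⟩ | ⟨u, v⟩) <;> linarith
  · refine ⟨fun h => by linarith, Or.inl ⟨by left; constructor <;> linarith, ?_⟩⟩
    rintro (⟨u, v⟩ | ⟨u, v⟩) <;> linarith
  · refine ⟨fun h => by linarith, Or.inr ⟨by right; constructor <;> linarith, ?_⟩⟩
    rintro (⟨u, v⟩ | ⟨u, v⟩) <;> linarith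

lemma cyc2 {a b c d : ℝ} (h : Cyc a b c d) :
    b ≠ d ∧ ((RBtw b c d ∧ ¬ RBtw b a d) ∨ (RBtw b a d ∧ ¬ RBtw b c d)) := by
  unfold Cyc at h; unfold RBtw
  rcases h with ⟨x, y, z⟩ | ⟨x, y, z⟩ | ⟨x, y, z⟩
  · refine ⟨fun h => by linarith, Or.inl ⟨by right; constructor <;> linarith, ?_⟩⟩
    rintro (⟨u, v⟩ | ⟨u, v⟩) <;> linarith
  · refine ⟨fun h => by linarith, Or.inl ⟨by left; constructor <;> linarith, ?_⟩⟩
    rintro (⟨u, v⟩ | ⟨u, v⟩) <;> linarith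
  · refine ⟨fun h => by linarith, Or.inl ⟨by left; constructor <;> linarith, ?_⟩⟩
    rintro (⟨u, v⟩ | ⟨u, v⟩) <;> linarith

lemma cw_diag1 (hC : CConv C) {a b c d : Pt} (h1 : CwLT C a b) (h2 : CwLT C b c) (h3 : CwLT C c d) :
    Diag a c b d := by
  rcases quad h1.ne (h1.tr h2).ne ((h1.tr h2).tr h3).ne h2.ne h3.ne (cw_cross hC h1 h2)
    (cw_cross hC h1 (h2.tr h3)) (cw_cross hC (h1.tr h2) h3) (cw_cross hC h2 h3) with h | ⟨k1, k2⟩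
  · exact h
  · rcases col4 (h1.tr h2).ne k1 k2 with h | ⟨m, k, ea, eb, ec, ed⟩
    · exact (cw_nohor h1 h2 h3 h).elim
    · have := cyc1 (cw_cyc hC h1 h2 h3 ea eb ec ed)
      exact diag_col ea eb ec ed this.1 this.2

lemma cw_diag2 (hC : CConv C) {a b c d : Pt} (h1 : CwLT C a b) (h2 : CwLT C b c) (h3 : CwLT C c d) :
    Diag b d c a := by
  rcases quad (a := b) (b := c) (c := d) (d := a) h2.ne (h2.tr h3).ne h1.ne.symm h3.ne
    ((h1.tr h2).tr h3).ne.symm (cw_cross hC h2 h3)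
    (by rw [cross2_cyc]; exact cw_cross hC h1 h2)
    (by rw [cross2_cyc]; exact cw_cross hC h1 (h2.tr h3))
    (by rw [cross2_cyc]; exact cw_cross hC (h1.tr h2) h3) with h | ⟨k1, k2⟩
  · exact h
  · rcases col4 (h2.tr h3).ne k1 k2 with ⟨x, y, z⟩ | ⟨m, k, eb, ec, ed, ea⟩
    · exact (cw_nohor h1 h2 h3 ⟨by linarith, by linarith, by linarith⟩).elim
    · have := cyc2 (cw_cyc hC h1 h2 h3 ea eb ec ed)
      exact diag_col eb ec ed ea this.1 this.2

end StaircaseCore4b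

section StaircaseCore4c

noncomputable def toB (x : Label) : BLab :=
  ⟨x.site, x.port, x.lo.1, x.hi.1, x.lo.2, x.hi.2, if x.site.2 ≤ x.port.2 then x.hi.2 else x.lo.2,
    x.isLeft⟩

lemma mem_seg {a b z : Pt} : z ∈ segment ℝ a b ↔ SSeg a b z := by
  rw [segment_eq_image']
  constructor
  · rintro ⟨t, ⟨h0, h1⟩, rfl⟩
    exact ⟨t, h0, h1, by ext <;> simp⟩
  · rintro ⟨t, h0, h1, rfl⟩
    exact ⟨t, ⟨h0, h1⟩, by ext <;> simp⟩

lemma mem_oseg {a b z : Pt} (h : OSeg a b z) : z ∈ openSegment ℝ a b := by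
  rw [openSegment_eq_image']
  obtain ⟨t, h0, h1, rfl⟩ := h
  exact ⟨t, ⟨h0, h1⟩, by ext <;> simp⟩

lemma mem_box {x : Label} {z : Pt} : z ∈ x.box ↔ (toB x).inBox z := by
  unfold Label.box BLab.inBox toB
  rw [Set.mem_Icc, Prod.le_def, Prod.le_def]
  tauto

lemma mem_lab {x : Label} {z : Pt} : z ∈ x.toSet ↔ (toB x).inT z := by
  unfold Label.toSet BLab.inT
  rw [Set.mem_union, mem_box, Label.leader, mem_seg]
  rfl

lemma mem_base {x : Label} {z : Pt} (h : (toB x).base z) : z ∈ x.baseline := by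
  obtain ⟨h1, h2⟩ := h
  unfold Label.baseline
  simp only [toB] at h1 h2
  rcases h2 with ⟨h2, h3⟩ | ⟨h2, h3⟩
  · rw [if_pos h2]
    split_ifs at h1 ⊢ with h <;> exact ⟨h1, h3⟩
  · rw [if_neg (by simp [h2])]
    split_ifs at h1 ⊢ with h <;> exact ⟨h1, h3⟩

lemma int_lr {C : Set Pt} {s : Pt} (hs : s ∈ interior C) :
    (∃ u ∈ C, u.2 = s.2 ∧ u.1 < s.1) ∧ (∃ u ∈ C, u.2 = s.2 ∧ s.1 < u.1) := by
  obtain ⟨ε, he, hb⟩ := Metric.mem_nhds_iff.1 (mem_interior_iff_mem_nhds.1 hs)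
  constructor
  · refine ⟨(s.1 - ε / 2, s.2), hb ?_, rfl, by simp only; linarith⟩
    rw [Metric.mem_ball, Prod.dist_eq]
    simp [abs_of_pos he, he]
  · refine ⟨(s.1 + ε / 2, s.2), hb ?_, rfl, by simp only; linarith⟩
    rw [Metric.mem_ball, Prod.dist_eq]
    simp [abs_of_pos he, he]

def nadj (n : ℕ) (i j : Fin n) : Prop := i ≠ j ∧ ((i.1 + 1) % n = j.1 ∨ (j.1 + 1) % n = i.1)

lemma cons_of {L : List Label} {i j : Fin L.length} (h : (i.1 + 1) % L.length = j.1) :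
    (L[i], L[j]) ∈ L.zip (L.rotate 1) := by
  rw [List.mem_iff_getElem]
  refine ⟨i.1, by simp, ?_⟩
  rw [List.getElem_zip]
  simp [List.getElem_rotate, h]

lemma nadj_cons {L : List Label} {i j : Fin L.length} (h : nadj L.length i j) :
    Consecutive L L[i] L[j] := by
  rcases h.2 with h | h
  · exact Or.inl (cons_of h)
  · exact Or.inr (cons_of h)

lemma diag_F {n : ℕ} {l : Fin n → BLab} {i j b b' : Fin n} (h : Diag (l i).p (l j).p (l b).p (l b').p)
    (hb : nadj n i b) (hb' : nadj n i b') : ∃ b b', nadj n i b ∧ nadj n i b' ∧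
    ((0 < cross2 (l i).p (l j).p (l b).p ∧ cross2 (l i).p (l j).p (l b').p < 0) ∨
     (OSeg (l i).p (l j).p (l b).p ∧ ¬ OSeg (l i).p (l j).p (l b').p)) := by
  rcases h with h | h | h | h
  · exact ⟨b, b', hb, hb', Or.inl h⟩
  · exact ⟨b', b, hb', hb, Or.inl h⟩
  · exact ⟨b, b', hb, hb', Or.inr h⟩
  · exact ⟨b', b, hb', hb, Or.inr h⟩

lemma nadj_succ {n : ℕ} {i j : Fin n} (h : i.1 + 1 = j.1) : nadj n i j := by
  refine ⟨fun e => by rw [e] at h; omega, Or.inl ?_⟩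
  rw [h]; exact Nat.mod_eq_of_lt j.2

lemma nadj_symm {n : ℕ} {i j : Fin n} (h : nadj n i j) : nadj n j i := ⟨h.1.symm, h.2.symm⟩

lemma nadj_wrap {n : ℕ} {i j : Fin n} (h : i.1 + 1 = n) (hj : j.1 = 0) (hij : i ≠ j) : nadj n i j :=
  ⟨hij, Or.inl (by rw [h, hj, Nat.mod_self])⟩

lemma F_all {C : Set Pt} (hC : CConv C) {n : ℕ} {l : Fin n → BLab}
    (hl : ∀ i j : Fin n, i.1 < j.1 → CwLT C (l i).p (l j).p) (i j : Fin n) (hij : i ≠ j)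
    (hn : ¬ nadj n i j) : ∃ b b', nadj n i b ∧ nadj n i b' ∧
    ((0 < cross2 (l i).p (l j).p (l b).p ∧ cross2 (l i).p (l j).p (l b').p < 0) ∨
     (OSeg (l i).p (l j).p (l b).p ∧ ¬ OSeg (l i).p (l j).p (l b').p)) := by
  have hi := i.2
  have hj := j.2
  have hne : i.1 ≠ j.1 := fun h => hij (Fin.ext h)
  have n1 : i.1 + 1 ≠ j.1 := fun h => hn (nadj_succ h)
  have n2 : j.1 + 1 ≠ i.1 := fun h => hn (nadj_symm (nadj_succ h))
  have n3 : ¬ (i.1 + 1 = n ∧ j.1 = 0) := fun h => hn (nadj_wrap h.1 h.2 hij)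
  have n4 : ¬ (j.1 + 1 = n ∧ i.1 = 0) := fun h => hn (nadj_symm (nadj_wrap h.1 h.2 hij.symm))
  rcases lt_or_gt_of_ne hne with h | h
  · let b : Fin n := ⟨i.1 + 1, by omega⟩
    have hb : nadj n i b := nadj_succ rfl
    have ib : i.1 < b.1 := by show i.1 < i.1 + 1; omega
    have bj : b.1 < j.1 := by show i.1 + 1 < j.1; omega
    by_cases h0 : i.1 = 0
    · let b' : Fin n := ⟨n - 1, by omega⟩
      have jb' : j.1 < b'.1 := by show j.1 < n - 1; omega
      have hb' : nadj n i b' := nadj_symm (nadj_wrap (by show n - 1 + 1 = n; omega) h0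
        (fun e => by rw [e] at jb'; omega))
      exact diag_F (cw_diag1 hC (hl _ _ ib) (hl _ _ bj) (hl _ _ jb')) hb hb'
    · let b' : Fin n := ⟨i.1 - 1, by omega⟩
      have b'i : b'.1 < i.1 := by show i.1 - 1 < i.1; omega
      have hb' : nadj n i b' := nadj_symm (nadj_succ (by show i.1 - 1 + 1 = i.1; omega))
      exact diag_F (cw_diag2 hC (hl _ _ b'i) (hl _ _ ib) (hl _ _ bj)) hb hb'
  · let b : Fin n := ⟨i.1 - 1, by omega⟩
    have hb : nadj n i b := nadj_symm (nadj_succ (by show i.1 - 1 + 1 = i.1; omega))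
    have ib : b.1 < i.1 := by show i.1 - 1 < i.1; omega
    have bj : j.1 < b.1 := by show j.1 < i.1 - 1; omega
    by_cases h0 : i.1 + 1 = n
    · let b' : Fin n := ⟨0, by omega⟩
      have b'j : b'.1 < j.1 := by show 0 < j.1; omega
      have hb' : nadj n i b' := nadj_wrap h0 rfl (fun e => by rw [e] at h; omega)
      exact diag_F (cw_diag2 hC (hl _ _ b'j) (hl _ _ bj) (hl _ _ ib)).symm hb hb'
    · let b' : Fin n := ⟨i.1 + 1, by omega⟩
      have ib' : i.1 < b'.1 := by show i.1 < i.1 + 1; omega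
      have hb' : nadj n i b' := nadj_succ rfl
      exact diag_F (cw_diag1 hC (hl _ _ bj) (hl _ _ ib) (hl _ _ ib')).symm hb hb'

theorem planar_core (C : Set Pt) (S : Finset Pt) (L : List Label)
    (hC : IsContour C) 
    (hSin : ∀ s ∈ S, s ∈ interior C) 
    (hlab : IsContourLabeling C S L)
    (hchains : PortsOnChains C L)
    (hstair : IsStaircase L)
    (hassum : Assumption1 S L)
    (hleaders : LeadersDisjoint L)
    (hcons : ConsecutiveDisjoint L) :
    PlanarList L := by
  have cc : CConv C := fun a ha b hb z hz => hC.convex.segment_subset ha hb (mem_seg.2 hz)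
  have mem : ∀ i : Fin L.length, L[i] ∈ L := fun i => List.getElem_mem _
  have val : ∀ i : Fin L.length, IsLabel C L[i] := fun i => hlab.valid _ (mem i)
  have hS : ∀ i : Fin L.length, (L[i]).site ∈ S := fun i =>
    (hlab.sites_iff _).2 (List.mem_map.2 ⟨_, mem i, rfl⟩)
  have hp2 : ∀ i : Fin L.length, (L[i]).port.2 ∈ Set.Icc (L[i]).lo.2 (L[i]).hi.2 := by
    intro i
    cases h : (L[i]).isLeft
    · exact ((val i).right_ok h).2
    · exact ((val i).left_ok h).2
  have hne : ∀ i j : Fin L.length, i ≠ j → L[i] ≠ L[j] := by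
    intro i j hij he
    apply hij
    have hn : L.Nodup := hlab.nodup_sites.of_map
    exact Fin.ext ((hn.getElem_inj_iff (hi := i.2) (hj := j.2)).1 he)
  have hcw : ∀ i j : Fin L.length, i.1 < j.1 → CwLT C (L[i]).port (L[j]).port := by
    have hr := hlab.radial
    unfold InRadialOrder at hr
    haveI : IsTrans Label (fun a b => CwLT C a.port b.port) := ⟨fun a b c h h' => h.tr h'⟩
    have hr' := List.isChain_iff_pairwise.1 hr
    intro i j hij
    exact List.pairwise_iff_getElem.1 hr' i.1 j.1 i.2 j.2 hij
  have hlead : ∀ i j : Fin L.length, i ≠ j → (L[i]).leader ∩ (L[j]).leader = ∅ := by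
    intro i j hij
    rcases lt_or_gt_of_ne (fun h => hij (Fin.ext h) : i.1 ≠ j.1) with h | h
    · exact List.pairwise_iff_getElem.1 hleaders i.1 j.1 i.2 j.2 h
    · rw [Set.inter_comm]
      exact List.pairwise_iff_getElem.1 hleaders j.1 i.1 j.2 i.2 h
  have sys : Sys C (interior C) (fun i : Fin L.length => toB L[i]) (nadj L.length) := by
    refine
      { conv := cc
        IC := fun z hz => interior_subset hz
        Iseg := fun s hs u hu z hz =>
          hC.convex.openSegment_interior_self_subset_interior hs hu (mem_oseg hz)
        Il := fun s hs => (int_lr hs).1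
        Ir := fun s hs => (int_lr hs).2
        xmin := ?_
        xmax := ?_
        sI := fun i => hSin _ (hS i)
        pC := fun i => (val i).leader_in (right_mem_segment ℝ _ _)
        pI := fun i => (val i).port_bd.2
        ab := fun i => (val i).lo_le_hi.1
        lp := fun i => (hp2 i).1
        ph := fun i => (hp2 i).2
        hl := fun i h => ⟨((val i).left_ok h).1, ((hchains _ (mem i)).1 h).2.2⟩
        hr := fun i h => ⟨((val i).right_ok h).1, ((hchains _ (mem i)).2 h).2.2⟩
        out := ?_
        hbl := ?_
        lead := ?_
        hull := ?_
        adjs := fun i j h => nadj_symm h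
        adjn := fun i j h => h.1
        adjd := ?_
        adjb := ?_
        F := ?_ }
    · obtain ⟨w, hw, h⟩ := hC.compact.exists_isMinOn (hC.nonempty_interior.mono interior_subset)
        (continuous_fst.continuousOn)
      exact ⟨w, hw, fun u hu => h hu⟩
    · obtain ⟨w, hw, h⟩ := hC.compact.exists_isMaxOn (hC.nonempty_interior.mono interior_subset)
        (continuous_fst.continuousOn)
      exact ⟨w, hw, fun u hu => h hu⟩
    · intro i u hu h1 h2 h3 h4
      have : u ∈ interior (L[i]).box ∩ C := by
        refine ⟨?_, hu⟩
        rw [Label.box, ← Prod.mk.eta (p := (L[i]).lo), ← Prod.mk.eta (p := (L[i]).hi),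
          ← Set.Icc_prod_Icc, interior_prod_eq, interior_Icc, interior_Icc]
        exact ⟨⟨h1, h2⟩, ⟨h3, h4⟩⟩
      rw [(val i).box_out] at this
      exact this
    · intro i
      simp only [toB]
      by_cases h : (L[i]).site.2 ≤ (L[i]).port.2
      · exact Or.inl ⟨if_pos h, h⟩
      · exact Or.inr ⟨if_neg h, (not_le.1 h).le⟩
    · intro i j hij z h1 h2
      have : z ∈ (L[i]).leader ∩ (L[j]).leader := ⟨mem_seg.2 h1, mem_seg.2 h2⟩
      rw [hlead i j hij] at this
      exact this
    · intro i j k z h1 h2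
      have : z ∈ (L[i]).box ∩ convexHull ℝ (S : Set Pt) :=
        ⟨mem_box.2 h2, (convex_convexHull ℝ _).segment_subset (subset_convexHull ℝ _ (hS j))
          (subset_convexHull ℝ _ (hS k)) (mem_seg.2 h1)⟩
      rw [hassum _ (mem i)] at this
      exact this
    · intro i j h z h1 h2
      have : z ∈ (L[i]).toSet ∩ (L[j]).toSet := ⟨mem_lab.2 h1, mem_lab.2 h2⟩
      rw [hcons _ _ (nadj_cons h) (hne i j h.1)] at this
      exact this
    · intro i j h z h1 h2
      have : z ∈ (L[j]).toSet ∩ (L[i]).baseline := ⟨mem_lab.2 h2, mem_base h1⟩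
      rw [(hstair _ _ (nadj_cons h)).2] at this
      exact this
    · intro i j hij hn
      exact F_all cc (l := fun i : Fin L.length => toB L[i]) hcw i j hij hn
  unfold PlanarList
  rw [List.pairwise_iff_getElem]
  intro i j hi hj hij
  rw [Set.eq_empty_iff_forall_notMem]
  rintro z ⟨h1, h2⟩
  exact sys.main (i := ⟨i, hi⟩) (j := ⟨j, hj⟩) (fun h => by simp at h; omega)
    (mem_lab.1 h1) (mem_lab.1 h2)

end StaircaseCore4c

/-- Lemma 1. If in a staircase contour labeling satisfying
Assumption 1, with ports on the proper chains, no two leaders intersect and no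
two consecutive labels intersect, then the labeling is planar. -/
theorem statement_0
    (C : Set Pt) (t : Pt) (S : Finset Pt) (L : List Label)
    (hC : IsContour C) (ht : IsTopmost C t)
    (hSin : ∀ s ∈ S, s ∈ interior C) (hgen : GenPos S)
    (hlab : IsContourLabeling C S L)
    (hchains : PortsOnChains C L)
    (hstair : IsStaircase L)
    (hassum : Assumption1 S L)
    (hleaders : LeadersDisjoint L)
    (hcons : ConsecutiveDisjoint L) :
    PlanarList L := by
  exact planar_core C S L hC hSin hlab hchains hstair hassum hleaders hcons
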